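/- arXiv:1110.6851 — 3 statements merged into one kernel-verified Lean document; each statement's English description precedes it below -/
import Mathlib

section
/- Let n ∈ ℕ, and let Z: Fin n → Set (Fin n) be such that for all i, j: j ∉ Z i implies Z i ⊆ Z j. For ε > 0 in a subfield F of ℝ, define the linear map α^ε: Fⁿ → Fⁿ by α^ε_i(z) = z_i + ε·∑_{j ∉ Z i} z_j. Then α^ε is invertible. -/
open Classical

/-- The linear endomorphism `z ↦ (z i + ε ∑_{j ∉ Z i} z j)_i`. -/
noncomputable def perturbedId {K ι : Type*} [CommRing K] [Fintype ι] (Z : ι → Set ι) (ε : K) :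
    (ι → K) →ₗ[K] (ι → K) where
  toFun z i := z i + ε * ∑ j ∈ Finset.univ.filter (fun j => j ∉ Z i), z j
  map_add' x y := by
    ext i
    simp only [Pi.add_apply, Finset.sum_add_distrib]
    ring
  map_smul' c x := by
    ext i
    simp only [Pi.smul_apply, smul_eq_mul, ← Finset.mul_sum, RingHom.id_apply]
    ring

lemma perturbedId_injective {K ι : Type*} [Field K] [LinearOrder K] [IsStrictOrderedRing K]
    [Fintype ι] (Z : ι → Set ι) (hZ : ∀ i j, j ∉ Z i → Z i ⊆ Z j) {ε : K} (hε : 0 < ε) :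
    Function.Injective (perturbedId Z ε) := by
  rw [injective_iff_map_eq_zero]
  intro z hz
  have eqn (i : ι) : z i + ε * ∑ j ∈ Finset.univ.filter (fun j => j ∉ Z i), z j = 0 :=
    congrFun hz i
  have vanish (S : Set ι) : ∀ i, Z i = S → z i = 0 := by
    induction S using (wellFounded_gt (α := Set ι)).induction with
    | _ S ih =>
      rintro i rfl
      have hterm : ∀ j ∈ Finset.univ.filter (fun j => j ∉ Z i),
          z j = (if Z j = Z i then 1 else 0) * z i := by
        intro j hj
        have hsub := hZ i j (by simpa using hj)
        split_ifs with h
        · have hj := eqn j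
          rw [h] at hj
          linear_combination hj - eqn i
        · rw [ih (Z j) (hsub.ssubset_of_ne (Ne.symm h)) j rfl, zero_mul]
      have hi := eqn i
      rw [Finset.sum_congr rfl hterm, ← Finset.sum_mul] at hi
      set k : K := ∑ j ∈ Finset.univ.filter (fun j => j ∉ Z i), if Z j = Z i then 1 else 0
      have hk : 0 ≤ k := Finset.sum_nonneg fun j _ => by split_ifs <;> norm_num
      have hpos : 1 + ε * k ≠ 0 := by positivity
      exact (mul_eq_zero.mp (by linear_combination hi : (1 + ε * k) * z i = 0)).resolve_left hpos
  exact funext fun i => vanish (Z i) i rfl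

/-- Let `Z : Fin n → Set (Fin n)` satisfy: `j ∉ Z i` implies `Z i ⊆ Z j`. For `ε > 0`
in a subfield `F` of `ℝ`, the linear map `α^ε : Fⁿ → Fⁿ` given by
`α^ε_i(z) = z_i + ε ∑_{j ∉ Z i} z_j` is invertible. -/
theorem stmt6 (F : Subfield ℝ) (n : ℕ) (Z : Fin n → Set (Fin n))
    (hZ : ∀ i j, j ∉ Z i → Z i ⊆ Z j) (ε : F) (hε : 0 < ε) :
    Function.Bijective (fun (z : Fin n → F) (i : Fin n) =>
      z i + ε * ∑ j ∈ Finset.univ.filter (fun j => j ∉ Z i), z j) := by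
  have hinj := perturbedId_injective Z hZ hε
  exact ⟨hinj, LinearMap.injective_iff_surjective.mp hinj⟩
end

section
/- Every finite-dimensional ordered directed vector space (V, V⁺) over a subfield F of ℝ with Riesz interpolation, of dimension n, is isomorphic (as an ordered vector space) to the inductive limit of a sequence (Fⁿ, F_{≥0}ⁿ) → (Fⁿ, F_{≥0}ⁿ) → ⋯ with positivity-preserving linear connecting maps. -/
set_option synthInstance.maxHeartbeats 1600000

open Module

universe u

/-- A directed, pointed convex cone with the Riesz decomposition property. -/
structure IsRieszCone (F : Subfield ℝ) {V : Type*} [AddCommGroup V] [Module F V]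
    (P : Set V) : Prop where
  zero_mem : (0 : V) ∈ P
  add_mem : ∀ {x y}, x ∈ P → y ∈ P → x + y ∈ P
  smul_mem : ∀ {c : F} {x}, 0 ≤ c → x ∈ P → c • x ∈ P
  eq_zero : ∀ {x}, x ∈ P → -x ∈ P → x = 0
  directed : ∀ v : V, ∃ a ∈ P, ∃ b ∈ P, v = a - b
  decomp : ∀ {x y z}, x ∈ P → y ∈ P → z ∈ P → y + z - x ∈ P →
    ∃ x₁ ∈ P, ∃ x₂ ∈ P, x = x₁ + x₂ ∧ y - x₁ ∈ P ∧ z - x₂ ∈ P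

/-- An order ideal: a directed, order-convex subspace. -/
structure IsOrderIdeal {F : Subfield ℝ} {V : Type*} [AddCommGroup V] [Module F V]
    (P : Set V) (I : Submodule F V) : Prop where
  hereditary : ∀ {x y}, x ∈ I → y ∈ P → x - y ∈ P → y ∈ I
  directed : ∀ {v}, v ∈ I → ∃ a ∈ P, ∃ b ∈ P, a ∈ I ∧ b ∈ I ∧ v = a - b

section

variable {F : Subfield ℝ} {V : Type*} [AddCommGroup V] [Module F V] {P : Set V}
  {M : Submodule F V}

namespace IsRieszCone

theorem sum_mem (h : IsRieszCone F P) {ι : Type*} (s : Finset ι) {f : ι → V}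
    (hf : ∀ i ∈ s, f i ∈ P) : ∑ i ∈ s, f i ∈ P :=
  Finset.sum_induction f (· ∈ P) (fun _ _ => h.add_mem) h.zero_mem hf

theorem restrict (h : IsRieszCone F P) (hM : IsOrderIdeal P M) :
    IsRieszCone F (M.subtype ⁻¹' P) where
  zero_mem := h.zero_mem
  add_mem hx hy := h.add_mem hx hy
  smul_mem hc hx := h.smul_mem hc hx
  eq_zero hx hy := Subtype.ext (h.eq_zero hx hy)
  directed v := by
    obtain ⟨a, ha, b, hb, haM, hbM, hv⟩ := hM.directed v.2
    exact ⟨⟨a, haM⟩, ha, ⟨b, hbM⟩, hb, Subtype.ext hv⟩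
  decomp := by
    rintro ⟨x, hxM⟩ y z hx hy hz hxyz
    obtain ⟨x₁, h₁, x₂, h₂, hx₁₂, hy₁, hz₂⟩ := h.decomp hx hy hz hxyz
    have hx₁₂' : x = x₁ + x₂ := hx₁₂
    refine ⟨⟨x₁, hM.hereditary hxM h₁ ?_⟩, h₁, ⟨x₂, hM.hereditary hxM h₂ ?_⟩, h₂,
      Subtype.ext hx₁₂', hy₁, hz₂⟩ <;> rw [hx₁₂'] <;> simpa

theorem quotient (h : IsRieszCone F P) (hM : IsOrderIdeal P M) :
    IsRieszCone F (M.mkQ '' P) where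
  zero_mem := ⟨0, h.zero_mem, map_zero _⟩
  add_mem := by
    rintro _ _ ⟨x, hx, rfl⟩ ⟨y, hy, rfl⟩
    exact ⟨x + y, h.add_mem hx hy, map_add _ _ _⟩
  smul_mem := by
    rintro c _ hc ⟨x, hx, rfl⟩
    exact ⟨c • x, h.smul_mem hc hx, map_smul _ _ _⟩
  eq_zero := by
    rintro _ ⟨p, hp, rfl⟩ ⟨q, hq, hpq⟩
    have : p + q ∈ M := by
      rw [← M.ker_mkQ, LinearMap.mem_ker, map_add, hpq, add_neg_cancel]
    rw [← LinearMap.mem_ker, M.ker_mkQ]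
    exact hM.hereditary this hp (by simpa)
  directed v := by
    obtain ⟨v, rfl⟩ := M.mkQ_surjective v
    obtain ⟨a, ha, b, hb, rfl⟩ := h.directed v
    exact ⟨_, ⟨a, ha, rfl⟩, _, ⟨b, hb, rfl⟩, map_sub _ _ _⟩
  decomp := by
    rintro _ _ _ ⟨x, hx, rfl⟩ ⟨y, hy, rfl⟩ ⟨z, hz, rfl⟩ ⟨p, hp, hxyz⟩
    have hmem : y + z - x - p ∈ M := by
      rw [← M.ker_mkQ, LinearMap.mem_ker]
      simp only [map_add, map_sub] at hxyz ⊢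
      rw [hxyz, sub_self]
    obtain ⟨a, ha, b, hb, haM, hbM, hab⟩ := hM.directed hmem
    obtain ⟨x₁, h₁, w, hw, rfl, hy₁, hw'⟩ := h.decomp hx hy (h.add_mem hz hb) (by
      have : y + (z + b) - x = p + a := by
        rw [← sub_eq_zero] at hab ⊢
        rw [← hab]; abel
      rw [this]; exact h.add_mem hp ha)
    obtain ⟨x₂, h₂, m, hm, rfl, hz₂, hm₂⟩ := h.decomp hw hz hb hw'
    have hmM : m ∈ M := hM.hereditary hbM hm hm₂
    refine ⟨_, ⟨x₁, h₁, rfl⟩, _, ⟨x₂, h₂, rfl⟩, by simpa, ⟨_, hy₁, map_sub _ _ _⟩,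
      ⟨_, hz₂, map_sub _ _ _⟩⟩

theorem exists_add_of_mem_sup (h : IsRieszCone F P) {I J : Submodule F V}
    (hI : IsOrderIdeal P I) (hJ : IsOrderIdeal P J) {x : V} (hx : x ∈ P) (hxIJ : x ∈ I ⊔ J) :
    ∃ y ∈ P, ∃ z ∈ P, y ∈ I ∧ z ∈ J ∧ x = y + z := by
  obtain ⟨v, hv, w, hw, rfl⟩ := Submodule.mem_sup.1 hxIJ
  obtain ⟨a, ha, b, hb, haI, hbI, rfl⟩ := hI.directed hv
  obtain ⟨c, hc, d, hd, hcJ, hdJ, rfl⟩ := hJ.directed hw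
  obtain ⟨y, hy, z, hz, hyz, hay, hcz⟩ := h.decomp hx ha hc (by
    have : a + c - (a - b + (c - d)) = b + d := by abel
    rw [this]; exact h.add_mem hb hd)
  exact ⟨y, hy, z, hz, hI.hereditary haI hy hay, hJ.hereditary hcJ hz hcz, hyz⟩

/-- The order ideal generated by a positive element. -/
def principal (h : IsRieszCone F P) (x : V) (_ : x ∈ P) : Submodule F V where
  carrier := {v | ∃ N : F, 0 ≤ N ∧ N • x - v ∈ P ∧ N • x + v ∈ P}
  zero_mem' := ⟨0, le_rfl, by simpa using h.zero_mem, by simpa using h.zero_mem⟩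
  add_mem' := by
    rintro v w ⟨N, hN, hv, hv'⟩ ⟨K, hK, hw, hw'⟩
    refine ⟨N + K, add_nonneg hN hK, ?_, ?_⟩
    · convert h.add_mem hv hw using 1; module
    · convert h.add_mem hv' hw' using 1; module
  smul_mem' := by
    rintro c v ⟨N, hN, hv, hv'⟩
    rcases le_total 0 c with hc | hc
    · refine ⟨c * N, mul_nonneg hc hN, ?_, ?_⟩
      · convert h.smul_mem hc hv using 1; module
      · convert h.smul_mem hc hv' using 1; module
    · refine ⟨-c * N, mul_nonneg (neg_nonneg.2 hc) hN, ?_, ?_⟩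
      · convert h.smul_mem (neg_nonneg.2 hc) hv' using 1; module
      · convert h.smul_mem (neg_nonneg.2 hc) hv using 1; module

theorem mem_principal_of_le (h : IsRieszCone F P) {x : V} (hx : x ∈ P) {N : F} (hN : 0 ≤ N)
    {v : V} (hv : v ∈ P) (hv' : N • x - v ∈ P) : v ∈ h.principal x hx :=
  ⟨N, hN, hv', h.add_mem (h.smul_mem hN hx) hv⟩

theorem self_mem_principal (h : IsRieszCone F P) {x : V} (hx : x ∈ P) :
    x ∈ h.principal x hx :=
  h.mem_principal_of_le hx zero_le_one hx (by simpa using h.zero_mem)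

theorem isOrderIdeal_principal (h : IsRieszCone F P) {x : V} (hx : x ∈ P) :
    IsOrderIdeal P (h.principal x hx) where
  hereditary := by
    rintro v w ⟨N, hN, hv, -⟩ hw hvw
    refine h.mem_principal_of_le hx hN hw ?_
    convert h.add_mem hv hvw using 1; abel
  directed := by
    rintro v ⟨N, hN, hv, hv'⟩
    have hNx : N • x ∈ h.principal x hx := Submodule.smul_mem _ _ (h.self_mem_principal hx)
    exact ⟨N • x + v, hv', N • x, h.smul_mem hN hx,
      Submodule.add_mem _ hNx ⟨N, hN, hv, hv'⟩, hNx, by abel⟩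

end IsRieszCone

namespace IsOrderIdeal

theorem comap_subtype (h : IsRieszCone F P) (hM : IsOrderIdeal P M) {I : Submodule F V}
    (hI : IsOrderIdeal P I) : IsOrderIdeal (M.subtype ⁻¹' P) (I.comap M.subtype) where
  hereditary hx hy hxy := hI.hereditary (x := M.subtype _) hx hy hxy
  directed := by
    rintro ⟨v, hvM⟩ hvI
    obtain ⟨a, ha, b, hb, haI, hbI, hab⟩ := hI.directed hvI
    obtain ⟨c, hc, d, hd, hcM, hdM, hcd⟩ := hM.directed hvM
    have hab' : v = a - b := hab
    obtain ⟨c₁, h₁, c₂, h₂, hc₁₂, hac, hdc⟩ := h.decomp hc ha hd (by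
      have : a + d - c = b := by
        rw [hab'] at hcd
        linear_combination (norm := module) hcd
      rwa [this])
    have h₁I : c₁ ∈ I := hI.hereditary haI h₁ hac
    have h₁M : c₁ ∈ M := hM.hereditary hcM h₁ (by rw [hc₁₂]; simpa)
    have hv : d - c₂ = c₁ - v := by rw [hcd, hc₁₂]; abel
    refine ⟨⟨c₁, h₁M⟩, h₁, ⟨d - c₂, ?_⟩, hdc, h₁I, ?_, Subtype.ext ?_⟩
    · rw [hv]; exact M.sub_mem h₁M hvM
    · change d - c₂ ∈ I
      rw [hv]; exact I.sub_mem h₁I hvI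
    · change v = c₁ - (d - c₂)
      rw [hv]; abel

theorem map_mkQ (h : IsRieszCone F P) (hM : IsOrderIdeal P M) {I : Submodule F V}
    (hI : IsOrderIdeal P I) : IsOrderIdeal (M.mkQ '' P) (I.map M.mkQ) where
  hereditary := by
    rintro _ _ ⟨x, hx, rfl⟩ ⟨p, hp, rfl⟩ ⟨q, hq, hpq⟩
    obtain ⟨a, ha, b, hb, haI, hbI, rfl⟩ := hI.directed hx
    have hmem : a - b - p - q ∈ M := by
      rw [← M.ker_mkQ, LinearMap.mem_ker]
      simp only [map_sub] at hpq ⊢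
      rw [hpq, sub_self]
    obtain ⟨m, hm, k, hk, hmM, hkM, hmk⟩ := hM.directed hmem
    obtain ⟨p₁, h₁, p₂, h₂, rfl, hap, hkp⟩ := h.decomp hp ha hk (by
      have : a + k - p = q + b + m := by linear_combination (norm := module) hmk
      rw [this]; exact h.add_mem (h.add_mem hq hb) hm)
    refine ⟨p₁, hI.hereditary haI h₁ hap, ?_⟩
    have : M.mkQ p₂ = 0 := by
      rw [← LinearMap.mem_ker, M.ker_mkQ]
      exact hM.hereditary hkM h₂ hkp
    rw [map_add, this, add_zero]
  directed := by
    rintro _ ⟨v, hv, rfl⟩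
    obtain ⟨a, ha, b, hb, haI, hbI, rfl⟩ := hI.directed hv
    exact ⟨_, ⟨a, ha, rfl⟩, _, ⟨b, hb, rfl⟩, ⟨a, haI, rfl⟩, ⟨b, hbI, rfl⟩, map_sub _ _ _⟩

theorem le_of_comap_eq_of_map_eq (h : IsRieszCone F P) (hM : IsOrderIdeal P M)
    {I J : Submodule F V} (hI : IsOrderIdeal P I) (hJ : IsOrderIdeal P J)
    (hcomap : I.comap M.subtype = J.comap M.subtype) (hmap : I.map M.mkQ = J.map M.mkQ) :
    I ≤ J := by
  have key : ∀ x ∈ P, x ∈ I → x ∈ J := by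
    intro x hx hxI
    have hxJM : x ∈ J ⊔ M := by
      have : M.mkQ x ∈ J.map M.mkQ := hmap ▸ Submodule.mem_map_of_mem hxI
      rw [← Submodule.mem_comap, Submodule.comap_map_mkQ] at this
      rwa [sup_comm]
    obtain ⟨y, hy, z, hz, hyJ, hzM, rfl⟩ := h.exists_add_of_mem_sup hJ hM hx hxJM
    have hzI : z ∈ I := hI.hereditary hxI hz (by simpa)
    have : (⟨z, hzM⟩ : M) ∈ J.comap M.subtype := hcomap ▸ hzI
    exact J.add_mem hyJ this
  intro v hv
  obtain ⟨a, ha, b, hb, haI, hbI, rfl⟩ := hI.directed hv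
  exact J.sub_mem (key a ha haI) (key b hb hbI)

end IsOrderIdeal

end

/-- Induction on dimension for Riesz cones: a property of finite-dimensional spaces with a Riesz
cone holds as soon as it holds for simple ones and is stable under extensions. -/
theorem IsRieszCone.induction {F : Subfield ℝ}
    {motive : (V : Type u) → [AddCommGroup V] → [Module F V] → Set V → Prop}
    (simple : ∀ (V : Type u) [AddCommGroup V] [Module F V] [FiniteDimensional F V] (P : Set V),
      IsRieszCone F P → (∀ I : Submodule F V, IsOrderIdeal P I → I = ⊥ ∨ I = ⊤) → motive V P)
    (extension : ∀ (V : Type u) [AddCommGroup V] [Module F V] [FiniteDimensional F V] (P : Set V)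
      (M : Submodule F V), IsRieszCone F P → IsOrderIdeal P M →
      motive M (M.subtype ⁻¹' P) → motive (V ⧸ M) (M.mkQ '' P) → motive V P)
    (V : Type u) [AddCommGroup V] [Module F V] [FiniteDimensional F V] (P : Set V)
    (h : IsRieszCone F P) : motive V P := by
  suffices H : ∀ (n : ℕ) (V : Type u) [AddCommGroup V] [Module F V] [FiniteDimensional F V]
      (P : Set V), IsRieszCone F P → finrank F V = n → motive V P from H _ V P h rfl
  intro n
  induction n using Nat.strong_induction_on with
  | _ n ih =>
    intro V _ _ _ P h hn
    by_cases hs : ∀ I : Submodule F V, IsOrderIdeal P I → I = ⊥ ∨ I = ⊤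
    · exact simple V P h hs
    · push Not at hs
      obtain ⟨M, hM, hbot, htop⟩ := hs
      have h₁ : finrank F M < n := hn ▸ Submodule.finrank_lt htop
      have h₂ : finrank F (V ⧸ M) < n := by
        have := M.finrank_quotient_add_finrank
        have : 0 < finrank F M := by
          rw [Nat.pos_iff_ne_zero, Ne, Submodule.finrank_eq_zero]; exact hbot
        omega
      exact extension V P M h hM (ih _ h₁ M _ (h.restrict hM) rfl)
        (ih _ h₂ (V ⧸ M) _ (h.quotient hM) rfl)

theorem IsRieszCone.countable_isOrderIdeal {F : Subfield ℝ} (V : Type u) [AddCommGroup V]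
    [Module F V] [FiniteDimensional F V] (P : Set V) (h : IsRieszCone F P) :
    {I : Submodule F V | IsOrderIdeal P I}.Countable := by
  refine IsRieszCone.induction
    (motive := fun V _ _ P => {I : Submodule F V | IsOrderIdeal P I}.Countable) ?_ ?_ V P h
  · intro V _ _ _ P h hs
    exact (Set.toFinite {⊥, ⊤}).countable.mono fun I hI => hs I hI
  · intro V _ _ _ P M h hM h₁ h₂
    refine Set.MapsTo.countable_of_injOn (f := fun I => (I.comap M.subtype, I.map M.mkQ))
      (fun I hI => Set.mk_mem_prod (hM.comap_subtype h hI) (hM.map_mkQ h hI)) ?_ (h₁.prod h₂)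
    intro I hI J hJ hIJ
    simp only [Prod.mk.injEq] at hIJ
    exact le_antisymm (hM.le_of_comap_eq_of_map_eq h hI hJ hIJ.1 hIJ.2)
      (hM.le_of_comap_eq_of_map_eq h hJ hI hIJ.1.symm hIJ.2.symm)

theorem IsRieszCone.exists_basis_mem {F : Subfield ℝ} {V : Type*} [AddCommGroup V]
    [Module F V] [FiniteDimensional F V] {P : Set V} (h : IsRieszCone F P) :
    ∃ b : Basis (Fin (finrank F V)) F V, ∀ i, b i ∈ P := by
  obtain ⟨s, hsP, hspan, hli⟩ := exists_linearIndependent F P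
  have htop : ⊤ ≤ Submodule.span F s := by
    rw [hspan]
    rintro v -
    obtain ⟨a, ha, b, hb, rfl⟩ := h.directed v
    exact sub_mem (Submodule.subset_span ha) (Submodule.subset_span hb)
  let b : Basis s F V := Basis.mk hli (by simpa using htop)
  have := Module.Finite.finite_basis b
  have := Fintype.ofFinite s
  let e : s ≃ Fin (finrank F V) :=
    Fintype.equivFinOfCardEq (Module.finrank_eq_card_basis b).symm
  refine ⟨b.reindex e, fun i => ?_⟩
  rw [Basis.reindex_apply, Basis.mk_apply]
  exact hsP (e.symm i).2

/-- A finite-dimensional Riesz cone is countably generated. -/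
theorem IsRieszCone.exists_generating_seq {F : Subfield ℝ} {V : Type u} [AddCommGroup V]
    [Module F V] [FiniteDimensional F V] {P : Set V} (h : IsRieszCone F P) :
    ∃ s : ℕ → V, (∀ i, s i ∈ P) ∧ ∀ T : Set V, (∀ i, s i ∈ T) →
      (∀ x ∈ T, ∀ y ∈ T, x + y ∈ T) → (∀ c : F, 0 ≤ c → ∀ x ∈ T, c • x ∈ T) → P ⊆ T := by
  have hb : ∀ I : Submodule F V, IsOrderIdeal P I →
      ∃ b : Basis (Fin (finrank F I)) F I, ∀ i, (b i : V) ∈ P :=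
    fun I hI => (h.restrict hI).exists_basis_mem
  choose b hbP using hb
  let S : Set V := ⋃ I : {I : Submodule F V | IsOrderIdeal P I},
    Set.range fun q : Fin (finrank F I.1) → ℚ => ∑ j, (q j : F) • (b I.1 I.2 j : V)
  have hS : S.Countable := by
    have := (h.countable_isOrderIdeal).to_subtype
    exact Set.countable_iUnion fun I => Set.countable_range _
  have hne : (P ∩ S).Nonempty := by
    refine ⟨0, h.zero_mem, Set.mem_iUnion.2 ⟨⟨_, h.isOrderIdeal_principal h.zero_mem⟩, 0, ?_⟩⟩
    simp
  obtain ⟨s, hs⟩ := (hS.mono (Set.inter_subset_right : P ∩ S ⊆ S)).exists_eq_range hne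
  have hsP : ∀ i, s i ∈ P ∩ S := fun i => hs ▸ Set.mem_range_self i
  refine ⟨s, fun i => (hsP i).1, fun T hT hadd hsmul x hx => ?_⟩
  replace hT : P ∩ S ⊆ T := by
    rw [hs]; rintro _ ⟨i, rfl⟩; exact hT i
  have hT0 : (0 : V) ∈ T := by simpa using hsmul 0 le_rfl _ (hT (hsP 0))
  have hI := h.isOrderIdeal_principal hx
  set I := h.principal x hx with hIdef
  set e := b I hI
  have heP := hbP I hI
  have hsum : ∀ c : Fin (finrank F I) → F, ((∑ j, c j • e j : I) : V) = ∑ j, c j • (e j : V) := by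
    intro c; simp
  set ξ := e.repr ⟨x, h.self_mem_principal hx⟩ with hξ
  have hxξ : x = ∑ j, ξ j • (e j : V) := by
    rw [← hsum, hξ, e.sum_repr]
  have hN : ∀ j, ∃ N : F, 0 ≤ N ∧ N • x - (e j : V) ∈ P ∧ N • x + (e j : V) ∈ P :=
    fun j => (e j).2
  choose N hN0 hN1 _ using hN
  have hNs : 0 ≤ ∑ j, N j := Finset.sum_nonneg fun j _ => hN0 j
  obtain ⟨ε, hε, hεN⟩ : ∃ ε : F, 0 < ε ∧ ε * ∑ j, N j ≤ 1 :=
    ⟨(1 + ∑ j, N j)⁻¹, by positivity, by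
      rw [inv_mul_le_iff₀ (by positivity)]; linarith⟩
  have hρ : ∀ j, ∃ q : ℚ, ξ j - ε < q ∧ q < ξ j := fun j => exists_rat_btwn (by linarith)
  choose ρ hρ1 hρ2 using hρ
  have hy : ∑ j, (ρ j : F) • (e j : V) ∈ P := by
    have heq : ∑ j, (ρ j : F) • (e j : V) = (1 - ∑ j, (ξ j - ρ j) * N j) • x +
        ∑ j, (ξ j - ρ j) • (N j • x - (e j : V)) := by
      have h1 : ∑ j, (ξ j - ρ j) • (N j • x - (e j : V)) =
          (∑ j, (ξ j - ρ j) * N j) • x - ∑ j, ξ j • (e j : V) + ∑ j, (ρ j : F) • (e j : V) := by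
        rw [Finset.sum_smul, ← Finset.sum_sub_distrib, ← Finset.sum_add_distrib]
        exact Finset.sum_congr rfl fun j _ => by module
      rw [h1, ← hxξ]; module
    rw [heq]
    refine h.add_mem (h.smul_mem ?_ hx) (h.sum_mem _ fun j _ => h.smul_mem ?_ (hN1 j))
    · have : ∑ j, (ξ j - ρ j) * N j ≤ ε * ∑ j, N j := by
        rw [Finset.mul_sum]
        exact Finset.sum_le_sum fun j _ =>
          mul_le_mul_of_nonneg_right (by linarith [hρ1 j]) (hN0 j)
      linarith
    · linarith [hρ2 j]
  have heT : ∀ j, (e j : V) ∈ T := fun j => by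
    refine hT ⟨heP j, Set.mem_iUnion.2 ⟨⟨I, hI⟩, Pi.single j 1, ?_⟩⟩
    classical
    change ∑ i, (((Pi.single j 1 : Fin (finrank F I) → ℚ) i : ℚ) : F) • (e i : V) = _
    rw [Finset.sum_eq_single j]
    · simp
    · intro i _ hij; simp [hij]
    · simp
  have hxe : x = ∑ j, (ρ j : F) • (e j : V) + ∑ j, (ξ j - ρ j) • (e j : V) := by
    rw [← Finset.sum_add_distrib]
    nth_rewrite 1 [hxξ]
    exact Finset.sum_congr rfl fun j _ => by module
  rw [hxe]
  refine hadd _ (hT ⟨hy, Set.mem_iUnion.2 ⟨⟨I, hI⟩, ρ, rfl⟩⟩) _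
    (Finset.sum_induction _ (· ∈ T) (fun a b ha hb => hadd a ha b hb) hT0 fun j _ =>
      hsmul _ (by linarith [hρ2 j]) _ (heT j))

open Matrix in
theorem Matrix.exists_subfield_approx {F : Subfield ℝ} {n : Type*} [Fintype n] [DecidableEq n]
    {G : Matrix n n ℝ} (hG : IsUnit G.det) (Y : Finset (n → ℝ))
    (hY : ∀ y ∈ Y, ∀ j, 0 < (G *ᵥ y) j) :
    ∃ B : Matrix n n F, IsUnit (B.map F.subtype).det ∧
      (∀ i j, 0 < (G * B.map F.subtype) i j) ∧
      ∀ y ∈ Y, ∀ j, 0 < ((B.map F.subtype)⁻¹ *ᵥ y) j := by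
  have hG' : G⁻¹.det ≠ 0 := (Matrix.isUnit_nonsing_inv_det G hG).ne_zero
  have hev : ∀ᶠ B in nhds G⁻¹, B.det ≠ 0 ∧ ∀ y ∈ Y, ∀ j, 0 < (B⁻¹ *ᵥ y) j := by
    refine (continuous_id.matrix_det.continuousAt.eventually_ne hG').and ?_
    rw [Filter.eventually_all_finset]
    intro y hy
    rw [Filter.eventually_all]
    intro j
    have hinv : ContinuousAt (Inv.inv : Matrix n n ℝ → Matrix n n ℝ) G⁻¹ := by
      apply continuousAt_matrix_inv
      rw [Ring.inverse_eq_inv']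
      exact continuousAt_inv₀ hG'
    have hc : ContinuousAt (fun B : Matrix n n ℝ => (B⁻¹ *ᵥ y) j) G⁻¹ := by
      have : Continuous fun B : Matrix n n ℝ => (B *ᵥ y) j := by fun_prop
      exact this.continuousAt.comp hinv
    refine hc.eventually (lt_mem_nhds ?_)
    simp only [Matrix.nonsing_inv_nonsing_inv G hG]
    exact hY y hy j
  have hpath : Filter.Tendsto (fun δ : ℝ => G⁻¹ * (1 + δ • Matrix.of fun _ _ : n => (1 : ℝ)))
      (nhdsWithin 0 (Set.Ioi 0)) (nhds G⁻¹) := by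
    have hc : Continuous fun δ : ℝ => G⁻¹ * (1 + δ • Matrix.of fun _ _ : n => (1 : ℝ)) := by
      fun_prop
    have := hc.tendsto 0
    simp only [zero_smul, add_zero, mul_one] at this
    exact this.mono_left nhdsWithin_le_nhds
  obtain ⟨δ, hδ, hδ0⟩ :=
    ((hpath.eventually (eventually_eventually_nhds.2 hev)).and self_mem_nhdsWithin).exists
  set B₀ := G⁻¹ * (1 + δ • Matrix.of fun _ _ : n => (1 : ℝ))
  have hpos : ∀ᶠ B in nhds B₀, ∀ i j, 0 < (G * B) i j := by
    simp_rw [Filter.eventually_all]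
    intro i j
    have hc : Continuous fun B : Matrix n n ℝ => (G * B) i j := by fun_prop
    refine hc.continuousAt.eventually (lt_mem_nhds ?_)
    have hGB : G * B₀ = 1 + δ • Matrix.of fun _ _ : n => (1 : ℝ) :=
      Matrix.mul_nonsing_inv_cancel_left _ _ hG
    simp only [hGB]
    have hδ0 : 0 < δ := hδ0
    by_cases hij : i = j
    · subst hij; simp; positivity
    · simpa [hij] using hδ0
  have hdense : DenseRange fun B : Matrix n n F => B.map F.subtype := by
    have hF : DenseRange (F.subtype : F → ℝ) :=
      Rat.denseRange_cast.mono (by rintro _ ⟨q, rfl⟩; exact ⟨q, by simp⟩)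
    exact DenseRange.piMap fun _ : n => DenseRange.piMap fun _ : n => hF
  obtain ⟨U, hUsub, hU, hBU⟩ := mem_nhds_iff.1 (hδ.and hpos)
  obtain ⟨B, hB⟩ := hdense.exists_mem_open hU ⟨_, hBU⟩
  obtain ⟨⟨h₁, h₂⟩, h₃⟩ := hUsub hB
  exact ⟨B, isUnit_iff_ne_zero.2 h₁, h₃, h₂⟩

section Dual

open scoped Matrix Pointwise

variable {F : Subfield ℝ} {V : Type*} [AddCommGroup V] [Module F V] {P : Set V}
  {n : Type*}

/-- The coordinates of a vector with respect to a basis, viewed as real numbers. -/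
noncomputable def realCoord (e : Basis n F V) : V →+ (n → ℝ) where
  toFun v i := (e.repr v i : ℝ)
  map_zero' := by ext; simp
  map_add' v w := by ext; simp

theorem realCoord_apply (e : Basis n F V) (v : V) (i : n) :
    realCoord e v i = (e.repr v i : ℝ) := rfl

theorem realCoord_smul (e : Basis n F V) (c : F) (v : V) :
    realCoord e (c • v) = (c : ℝ) • realCoord e v := by
  ext; simp [realCoord_apply]

variable [Fintype n]

theorem dotProduct_realCoord_basis (e : Basis n F V) (a : n → ℝ) (j : n) :
    a ⬝ᵥ realCoord e (e j) = a j := by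
  classical
  have : realCoord e (e j) = Pi.single j 1 := by
    ext i
    by_cases hij : i = j
    · subst hij; simp [realCoord_apply]
    · simp [realCoord_apply, hij]
  rw [this, dotProduct_single_one]

/-- The cone of positive real functionals, in coordinates. -/
def dualCone (P : Set V) (e : Basis n F V) : Set (n → ℝ) :=
  {a | ∀ x ∈ P, 0 ≤ a ⬝ᵥ realCoord e x}

theorem dualCone_add_mem {e : Basis n F V} {a b : n → ℝ} (ha : a ∈ dualCone P e)
    (hb : b ∈ dualCone P e) : a + b ∈ dualCone P e := fun x hx => by
  rw [add_dotProduct]; exact add_nonneg (ha x hx) (hb x hx)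

theorem dualCone_smul_mem {e : Basis n F V} {a : n → ℝ} {t : ℝ} (ht : 0 ≤ t)
    (ha : a ∈ dualCone P e) : t • a ∈ dualCone P e := fun x hx => by
  rw [smul_dotProduct]; exact mul_nonneg ht (ha x hx)

theorem dualCone_sum_mem {e : Basis n F V} {ι : Type*} (s : Finset ι) {f : ι → n → ℝ}
    (hf : ∀ i ∈ s, f i ∈ dualCone P e) : ∑ i ∈ s, f i ∈ dualCone P e :=
  Finset.sum_induction f (· ∈ dualCone P e) (fun _ _ => dualCone_add_mem)
    (fun x _ => by simp) hf

/-- The base of the dual cone cut out by a positive element. -/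
def dualBase (P : Set V) (e : Basis n F V) (u : V) : Set (n → ℝ) :=
  {a | a ∈ dualCone P e ∧ a ⬝ᵥ realCoord e u = 1}

theorem isClosed_dualCone (e : Basis n F V) : IsClosed (dualCone P e) := by
  have : dualCone P e = ⋂ x ∈ P, {a | 0 ≤ a ⬝ᵥ realCoord e x} := by
    ext; simp [dualCone]
  rw [this]
  exact isClosed_biInter fun x _ => isClosed_le continuous_const (by fun_prop)

theorem convex_dualBase (e : Basis n F V) (u : V) : Convex ℝ (dualBase P e u) := by
  rintro a ⟨ha, ha'⟩ b ⟨hb, hb'⟩ s t hs ht hst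
  refine ⟨dualCone_add_mem (dualCone_smul_mem hs ha) (dualCone_smul_mem ht hb), ?_⟩
  rw [add_dotProduct, smul_dotProduct, smul_dotProduct, ha', hb']
  simpa using hst

namespace IsRieszCone

/-- An additive, positively homogeneous function on the cone is given by a functional. -/
theorem exists_dotProduct_eq (h : IsRieszCone F P) (e : Basis n F V) (he : ∀ i, e i ∈ P)
    {f : V → ℝ} (hadd : ∀ x ∈ P, ∀ y ∈ P, f (x + y) = f x + f y)
    (hsmul : ∀ c : F, 0 < c → ∀ x ∈ P, f (c • x) = c * f x) :
    ∃ a : n → ℝ, ∀ x ∈ P, f x = a ⬝ᵥ realCoord e x := by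
  have h0 : f 0 = 0 := by
    have := hadd 0 h.zero_mem 0 h.zero_mem
    rw [add_zero] at this; linarith
  have hsmul' : ∀ c : F, 0 ≤ c → ∀ x ∈ P, f (c • x) = c * f x := by
    intro c hc x hx
    rcases hc.eq_or_lt with rfl | hc
    · simp [h0]
    · exact hsmul c hc x hx
  have hsum : ∀ c : n → F, (∀ i, 0 ≤ c i) → f (∑ i, c i • e i) = ∑ i, (c i : ℝ) * f (e i) := by
    intro c hc
    have H : ∀ s : Finset n, f (∑ i ∈ s, c i • e i) = ∑ i ∈ s, (c i : ℝ) * f (e i) := by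
      classical
      intro s
      induction s using Finset.induction_on with
      | empty => simp [h0]
      | insert i s hi ih =>
        rw [Finset.sum_insert hi, Finset.sum_insert hi, hadd _ (h.smul_mem (hc i) (he i)) _
          (h.sum_mem _ fun j _ => h.smul_mem (hc j) (he j)), ih, hsmul' _ (hc i) _ (he i)]
    exact H _
  refine ⟨fun i => f (e i), fun x hx => ?_⟩
  have hx' : x + ∑ i, (max (-e.repr x i) 0) • e i = ∑ i, (max (e.repr x i) 0) • e i := by
    nth_rewrite 1 [← e.sum_repr x]
    rw [← Finset.sum_add_distrib]
    refine Finset.sum_congr rfl fun i _ => ?_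
    rw [← add_smul]
    congr 1
    linear_combination -max_zero_sub_max_neg_zero_eq_self (e.repr x i)
  have hf := congrArg f hx'
  rw [hadd x hx _ (h.sum_mem _ fun i _ => h.smul_mem (le_max_right _ _) (he i)),
    hsum _ fun i => le_max_right _ _, hsum _ fun i => le_max_right _ _] at hf
  rw [eq_sub_of_add_eq hf, ← Finset.sum_sub_distrib]
  refine Finset.sum_congr rfl fun i _ => ?_
  rw [realCoord_apply, ← sub_mul, mul_comm, ← F.coe_sub, max_zero_sub_max_neg_zero_eq_self]

/-- The dual of a Riesz cone has the Riesz decomposition property. -/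
theorem dualCone_decomp (h : IsRieszCone F P) (e : Basis n F V) (he : ∀ i, e i ∈ P)
    {a b c : n → ℝ} (ha : a ∈ dualCone P e) (hb : b ∈ dualCone P e) (hc : c ∈ dualCone P e)
    (habc : b + c - a ∈ dualCone P e) :
    ∃ d ∈ dualCone P e, b - d ∈ dualCone P e ∧ a - d ∈ dualCone P e ∧
      c - (a - d) ∈ dualCone P e := by
  let S : V → Set ℝ := fun x =>
    {r | ∃ y ∈ P, ∃ z ∈ P, y + z = x ∧ a ⬝ᵥ realCoord e y + b ⬝ᵥ realCoord e z = r}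
  have hbdd : ∀ x, BddBelow (S x) := by
    refine fun x => ⟨0, ?_⟩
    rintro _ ⟨y, hy, z, hz, -, rfl⟩
    exact add_nonneg (ha y hy) (hb z hz)
  have hne : ∀ x ∈ P, (S x).Nonempty := fun x hx =>
    ⟨_, x, hx, 0, h.zero_mem, add_zero x, rfl⟩
  have hS : ∀ x ∈ P, ∀ y ∈ P, S (x + y) = S x + S y := by
    intro x hx y hy
    ext r
    rw [Set.mem_add]
    constructor
    · rintro ⟨p, hp, q, hq, hpq, rfl⟩
      obtain ⟨p₁, h₁, p₂, h₂, rfl, hx₁, hy₂⟩ := h.decomp hp hx hy (by rw [← hpq]; simpa)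
      refine ⟨_, ⟨p₁, h₁, _, hx₁, by abel, rfl⟩, _, ⟨p₂, h₂, _, hy₂, by abel, rfl⟩, ?_⟩
      have : q = (x - p₁) + (y - p₂) := by
        linear_combination (norm := module) hpq
      rw [this]
      simp only [map_add, dotProduct_add]
      ring
    · rintro ⟨_, ⟨y₁, hy₁, z₁, hz₁, rfl, rfl⟩, _, ⟨y₂, hy₂, z₂, hz₂, rfl, rfl⟩, rfl⟩
      refine ⟨_, h.add_mem hy₁ hy₂, _, h.add_mem hz₁ hz₂, by abel, ?_⟩
      simp only [map_add, dotProduct_add]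
      ring
  have hS' : ∀ c : F, 0 < c → ∀ x, S (c • x) = (c : ℝ) • S x := by
    intro c hc x
    have hc' : (c : ℝ) ≠ 0 := by exact_mod_cast hc.ne'
    ext r
    rw [Set.mem_smul_set]
    constructor
    · rintro ⟨y, hy, z, hz, hyz, rfl⟩
      refine ⟨_, ⟨c⁻¹ • y, h.smul_mem (inv_nonneg.2 hc.le) hy, c⁻¹ • z,
        h.smul_mem (inv_nonneg.2 hc.le) hz, ?_, rfl⟩, ?_⟩
      · rw [← smul_add, hyz, inv_smul_smul₀ hc.ne']
      · simp only [realCoord_smul, dotProduct_smul, smul_eq_mul, F.coe_inv]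
        field_simp
    · rintro ⟨_, ⟨y, hy, z, hz, rfl, rfl⟩, rfl⟩
      refine ⟨c • y, h.smul_mem hc.le hy, c • z, h.smul_mem hc.le hz, (smul_add _ _ _).symm, ?_⟩
      simp only [realCoord_smul, dotProduct_smul, smul_eq_mul]
      ring
  obtain ⟨d, hd⟩ := h.exists_dotProduct_eq e he (f := fun x => sInf (S x))
    (fun x hx y hy => by
      simp only [hS x hx y hy]
      exact csInf_add (hne x hx) (hbdd x) (hne y hy) (hbdd y))
    (fun c hc x hx => by
      simp only [hS' c hc x]
      have : (0 : ℝ) ≤ c := by exact_mod_cast hc.le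
      rw [Real.sInf_smul_of_nonneg this, smul_eq_mul])
  refine ⟨d, fun x hx => ?_, fun x hx => ?_, fun x hx => ?_, fun x hx => ?_⟩
  · rw [← hd x hx]
    refine le_csInf (hne x hx) ?_
    rintro _ ⟨y, hy, z, hz, -, rfl⟩
    exact add_nonneg (ha y hy) (hb z hz)
  · rw [sub_dotProduct, ← hd x hx, sub_nonneg]
    exact csInf_le (hbdd x) ⟨0, h.zero_mem, x, hx, zero_add x, by simp⟩
  · rw [sub_dotProduct, ← hd x hx, sub_nonneg]
    exact csInf_le (hbdd x) ⟨x, hx, 0, h.zero_mem, add_zero x, by simp⟩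
  · have : a ⬝ᵥ realCoord e x - c ⬝ᵥ realCoord e x ≤ d ⬝ᵥ realCoord e x := by
      rw [← hd x hx]
      refine le_csInf (hne x hx) ?_
      rintro _ ⟨y, hy, z, hz, rfl, rfl⟩
      have h₁ := habc z hz
      have h₂ := hc y hy
      simp only [sub_dotProduct, add_dotProduct, map_add, dotProduct_add] at h₁ ⊢
      linarith
    simp only [sub_dotProduct]
    linarith

/-- Order units, in a form convenient for vectors of both signs. -/
theorem exists_smul_sub_mem (h : IsRieszCone F P)
    (hs : ∀ I : Submodule F V, IsOrderIdeal P I → I = ⊥ ∨ I = ⊤) {u : V} (hu : u ∈ P)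
    (hu0 : u ≠ 0) (v : V) : ∃ N : F, 0 ≤ N ∧ N • u - v ∈ P := by
  rcases hs _ (h.isOrderIdeal_principal hu) with hI | hI
  · have := h.self_mem_principal hu
    rw [hI, Submodule.mem_bot] at this
    exact absurd this hu0
  · obtain ⟨N, hN, hv, -⟩ : v ∈ h.principal u hu := hI ▸ Submodule.mem_top
    exact ⟨N, hN, hv⟩

end IsRieszCone

end Dual

section Simple

open scoped Matrix

variable {F : Subfield ℝ} {V : Type*} [AddCommGroup V] [Module F V] {P : Set V}
  {n : Type*} [Fintype n]

theorem le_mul_dotProduct_of_mem_dualCone {e : Basis n F V} {a : n → ℝ}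
    (ha : a ∈ dualCone P e) {u x : V} {N : F} (hN : N • u - x ∈ P) :
    a ⬝ᵥ realCoord e x ≤ N * a ⬝ᵥ realCoord e u := by
  have := ha _ hN
  rw [map_sub, realCoord_smul, dotProduct_sub, dotProduct_smul, smul_eq_mul] at this
  linarith

theorem eq_zero_of_mem_dualCone {e : Basis n F V} (he : ∀ i, e i ∈ P) {u : V}
    (hN : ∀ v, ∃ N : F, 0 ≤ N ∧ N • u - v ∈ P) {a : n → ℝ} (ha : a ∈ dualCone P e)
    (hau : a ⬝ᵥ realCoord e u = 0) : a = 0 := by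
  ext j
  obtain ⟨N, -, hN⟩ := hN (e j)
  have h₁ := le_mul_dotProduct_of_mem_dualCone ha hN
  have h₂ := ha _ (he j)
  rw [dotProduct_realCoord_basis] at h₁ h₂
  rw [hau, mul_zero] at h₁
  exact le_antisymm h₁ h₂

theorem isCompact_dualBase (e : Basis n F V) (he : ∀ i, e i ∈ P) {u : V}
    (hN : ∀ v, ∃ N : F, 0 ≤ N ∧ N • u - v ∈ P) : IsCompact (dualBase P e u) := by
  choose N _ hN using hN
  refine (isCompact_Icc (a := (0 : n → ℝ)) (b := fun i => (N (e i) : ℝ))).of_isClosed_subset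
    ((isClosed_dualCone e).inter (isClosed_eq (by fun_prop) continuous_const)) ?_
  rintro a ⟨ha, ha'⟩
  refine ⟨fun i => ?_, fun i => ?_⟩
  · simpa [dotProduct_realCoord_basis] using ha _ (he i)
  · have := le_mul_dotProduct_of_mem_dualCone ha (hN (e i))
    rwa [dotProduct_realCoord_basis, ha', mul_one] at this

/-- Extreme points of the base span extreme rays of the dual cone. -/
theorem exists_eq_smul_of_mem_extremePoints {e : Basis n F V} (he : ∀ i, e i ∈ P) {u : V}
    (hu : u ∈ P) (hN : ∀ v, ∃ N : F, 0 ≤ N ∧ N • u - v ∈ P) {a g : n → ℝ}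
    (ha : a ∈ (dualBase P e u).extremePoints ℝ) {t : ℝ} (hg : g ∈ dualCone P e)
    (hag : t • a - g ∈ dualCone P e) : ∃ s : ℝ, g = s • a := by
  rw [mem_extremePoints] at ha
  obtain ⟨⟨haD, hau⟩, hext⟩ := ha
  have hα := hg u hu
  have hβ := hag u hu
  have hβ' : (t • a - g) ⬝ᵥ realCoord e u = t - g ⬝ᵥ realCoord e u := by
    rw [sub_dotProduct, smul_dotProduct, hau, smul_eq_mul, mul_one]
  rcases hα.eq_or_lt with hα | hα
  · exact ⟨0, by rw [eq_zero_of_mem_dualCone he hN hg hα.symm, zero_smul]⟩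
  rcases hβ.eq_or_lt with hβ | hβ
  · exact ⟨t, (sub_eq_zero.1 (eq_zero_of_mem_dualCone he hN hag hβ.symm)).symm⟩
  set α := g ⬝ᵥ realCoord e u
  rw [hβ'] at hβ
  have ht : 0 < t := by linarith
  have h₁ : α⁻¹ • g ∈ dualBase P e u :=
    ⟨dualCone_smul_mem (inv_nonneg.2 hα.le) hg, by
      rw [smul_dotProduct, smul_eq_mul]; exact inv_mul_cancel₀ hα.ne'⟩
  have h₂ : (t - α)⁻¹ • (t • a - g) ∈ dualBase P e u :=
    ⟨dualCone_smul_mem (inv_nonneg.2 hβ.le) hag, by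
      rw [smul_dotProduct, smul_eq_mul, hβ']; exact inv_mul_cancel₀ hβ.ne'⟩
  have h₃ : a ∈ openSegment ℝ (α⁻¹ • g) ((t - α)⁻¹ • (t • a - g)) := by
    refine ⟨α / t, (t - α) / t, div_pos hα ht, div_pos hβ ht, by field_simp; ring, ?_⟩
    ext i
    simp only [Pi.add_apply, Pi.smul_apply, Pi.sub_apply, smul_eq_mul]
    have := hβ.ne'
    field_simp
    ring
  have := (hext _ h₁ _ h₂ h₃).1
  exact ⟨α, by rw [← this, smul_inv_smul₀ hα.ne']⟩

namespace IsRieszCone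

theorem not_sum_sub_mem_dualCone (h : IsRieszCone F P) {e : Basis n F V} (he : ∀ i, e i ∈ P)
    {u : V} (hu : u ∈ P) (hN : ∀ v, ∃ N : F, 0 ≤ N ∧ N • u - v ∈ P) {a : n → ℝ}
    (ha : a ∈ (dualBase P e u).extremePoints ℝ) {t : ℝ} (ht : 0 < t) {w : (n → ℝ) → ℝ}
    (hw : ∀ b, 0 ≤ w b) (s : Finset (n → ℝ)) (hs : ↑s ⊆ (dualBase P e u).extremePoints ℝ)
    (has : a ∉ s) : ∑ b ∈ s, w b • b - t • a ∉ dualCone P e := by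
  classical
  have hmem : ∀ {b}, b ∈ (dualBase P e u).extremePoints ℝ → b ∈ dualCone P e :=
    fun hb => (extremePoints_subset hb).1
  induction s using Finset.induction_on with
  | empty =>
    intro hneg
    have := hneg u hu
    rw [Finset.sum_empty, zero_sub, neg_dotProduct, smul_dotProduct,
      (extremePoints_subset ha).2, smul_eq_mul] at this
    linarith
  | insert b s hb ih =>
    intro hmem'
    rw [Finset.coe_insert, Set.insert_subset_iff] at hs
    rw [Finset.sum_insert hb] at hmem'
    obtain ⟨d, hd, hbd, had, hcd⟩ := h.dualCone_decomp e he
      (dualCone_smul_mem ht.le (hmem ha)) (dualCone_smul_mem (hw b) (hmem hs.1))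
      (dualCone_sum_mem s fun c hc => dualCone_smul_mem (hw c) (hmem (hs.2 hc))) hmem'
    obtain ⟨s₁, rfl⟩ := exists_eq_smul_of_mem_extremePoints he hu hN ha hd had
    obtain ⟨s₂, hs₂⟩ := exists_eq_smul_of_mem_extremePoints he hu hN hs.1 hd hbd
    have hss : s₁ = s₂ := by
      have := congrArg (· ⬝ᵥ realCoord e u) hs₂
      simpa [smul_dotProduct, (extremePoints_subset ha).2, (extremePoints_subset hs.1).2]
        using this
    subst hss
    have hs₁ : s₁ = 0 := by
      by_contra hne
      exact has (Finset.mem_insert.2 (Or.inl (smul_right_injective _ hne hs₂)))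
    rw [hs₁, zero_smul, sub_zero] at hcd
    exact ih hs.2 (fun hmem => has (Finset.mem_insert_of_mem hmem)) hcd

theorem linearIndepOn_extremePoints (h : IsRieszCone F P) {e : Basis n F V}
    (he : ∀ i, e i ∈ P) {u : V} (hu : u ∈ P) (hN : ∀ v, ∃ N : F, 0 ≤ N ∧ N • u - v ∈ P) :
    LinearIndepOn ℝ id ((dualBase P e u).extremePoints ℝ) := by
  classical
  have key : ∀ (s : Finset (n → ℝ)) (g : (n → ℝ) → ℝ),
      ↑s ⊆ (dualBase P e u).extremePoints ℝ → ∑ b ∈ s, g b • b = 0 → ∀ a ∈ s, g a ≤ 0 := by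
    intro s g hs hg a ha
    by_contra! hpos
    refine h.not_sum_sub_mem_dualCone he hu hN (hs ha) hpos (w := fun b => max (-g b) 0)
      (fun b => le_max_right _ _) (s.erase a)
      ((Finset.coe_subset.2 (Finset.erase_subset a s)).trans hs) (Finset.notMem_erase a s) ?_
    have : ∑ b ∈ s.erase a, max (-g b) 0 • b - g a • a =
        ∑ b ∈ s.erase a, (max (-g b) 0 + g b) • b := by
      rw [← Finset.sum_erase_add _ _ ha] at hg
      simp only [add_smul, Finset.sum_add_distrib]
      rw [eq_neg_of_add_eq_zero_left hg, sub_eq_add_neg]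
    rw [this]
    refine dualCone_sum_mem _ fun b hb => dualCone_smul_mem ?_
      (extremePoints_subset (hs (Finset.mem_of_mem_erase hb))).1
    linarith [le_max_left (-g b) 0]
  rw [linearIndepOn_iff']
  intro s g hs hg a ha
  refine le_antisymm (key s g hs hg a ha) ?_
  have := key s (fun b => -g b) hs (by simpa using hg) a ha
  linarith

/-- A vector on which no positive functional is negative is approximated by the cone. -/
theorem mem_closure_of_dualCone (h : IsRieszCone F P) (e : Basis n F V) {x : V}
    (hx : ∀ a ∈ dualCone P e, 0 ≤ a ⬝ᵥ realCoord e x) :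
    realCoord e x ∈ closure (realCoord e '' P) := by
  classical
  set C := closure (realCoord e '' P) with hC
  have hadd : ∀ y ∈ C, ∀ z ∈ C, y + z ∈ C := fun y hy z hz =>
    map_mem_closure₂ continuous_add hy hz (by
      rintro _ ⟨p, hp, rfl⟩ _ ⟨q, hq, rfl⟩
      exact ⟨p + q, h.add_mem hp hq, map_add _ _ _⟩)
  have hsmul : ∀ r : ℝ, 0 ≤ r → ∀ y ∈ C, r • y ∈ C := by
    intro r hr y hy
    have hr' : r ∈ closure {r : ℝ | ∃ c : F, 0 ≤ c ∧ (c : ℝ) = r} := by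
      rw [Metric.mem_closure_iff]
      intro ε hε
      obtain ⟨q, hq₁, hq₂⟩ := exists_rat_btwn (lt_add_of_pos_right r hε)
      refine ⟨q, ⟨(q : F), ?_, by simp⟩, ?_⟩
      · exact_mod_cast (hr.trans hq₁.le)
      · rw [Real.dist_eq, abs_lt]; constructor <;> linarith
    refine map_mem_closure₂ continuous_smul hr' hy ?_
    rintro _ ⟨c, hc, rfl⟩ _ ⟨p, hp, rfl⟩
    exact ⟨c • p, h.smul_mem hc hp, realCoord_smul _ _ _⟩
  have hconv : Convex ℝ C := fun y hy z hz s t hs ht _ =>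
    hadd _ (hsmul s hs y hy) _ (hsmul t ht z hz)
  by_contra hxC
  obtain ⟨f, s, hfx, hfC⟩ := geometric_hahn_banach_point_closed hconv isClosed_closure hxC
  have h0 : (0 : n → ℝ) ∈ C := subset_closure ⟨0, h.zero_mem, map_zero _⟩
  have hs : s < 0 := by simpa using hfC 0 h0
  have hnn : ∀ y ∈ C, 0 ≤ f y := by
    intro y hy
    by_contra! hneg
    have := hfC _ (hsmul (s / f y) (div_nonneg_of_nonpos hs.le hneg.le) y hy)
    rw [map_smul, smul_eq_mul, div_mul_cancel₀ _ hneg.ne] at this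
    exact lt_irrefl _ this
  have hf : ∀ y, f y = (fun i => f (Pi.single i 1)) ⬝ᵥ y := by
    intro y
    conv_lhs => rw [pi_eq_sum_univ' y]
    simp [dotProduct, mul_comm]
  have := hx _ (fun p hp => by
    rw [← hf]; exact hnn _ (subset_closure ⟨p, hp, rfl⟩))
  rw [← hf] at this
  linarith

/-- Strict positivity on the base of the dual cone characterises positivity. -/
theorem mem_of_forall_dualBase_pos (h : IsRieszCone F P) {e : Basis n F V}
    (he : ∀ i, e i ∈ P) {u : V} (hu : u ∈ P) (hN : ∀ v, ∃ N : F, 0 ≤ N ∧ N • u - v ∈ P)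
    {x : V} (hx : ∀ a ∈ dualBase P e u, 0 < a ⬝ᵥ realCoord e x) : x ∈ P := by
  obtain ⟨ε, hε, hεx⟩ : ∃ ε : F, 0 < ε ∧ ∀ a ∈ dualBase P e u, (ε : ℝ) ≤ a ⬝ᵥ realCoord e x := by
    obtain ⟨r, hr, hrx⟩ : ∃ r : ℝ, 0 < r ∧ ∀ a ∈ dualBase P e u, r ≤ a ⬝ᵥ realCoord e x := by
      rcases (dualBase P e u).eq_empty_or_nonempty with hB | hB
      · exact ⟨1, one_pos, by simp [hB]⟩
      · obtain ⟨a, ha, hmin⟩ := (isCompact_dualBase e he hN).exists_isMinOn hB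
          (f := fun a => a ⬝ᵥ realCoord e x) (by fun_prop)
        exact ⟨_, hx a ha, fun b hb => hmin hb⟩
    obtain ⟨q, hq₀, hq⟩ := exists_rat_btwn hr
    refine ⟨(q : F), by exact_mod_cast hq₀, fun a ha => ?_⟩
    have := hrx a ha
    simp only [SubfieldClass.coe_ratCast]
    linarith
  have hcl : realCoord e (x - ε • u) ∈ closure (realCoord e '' P) := by
    refine h.mem_closure_of_dualCone e fun a ha => ?_
    rw [map_sub, realCoord_smul, dotProduct_sub, dotProduct_smul, smul_eq_mul, sub_nonneg]
    rcases (ha u hu).eq_or_lt with h0 | h0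
    · rw [eq_zero_of_mem_dualCone he hN ha h0.symm]; simp
    · set t := a ⬝ᵥ realCoord e u
      have := hεx (t⁻¹ • a) ⟨dualCone_smul_mem (inv_nonneg.2 h0.le) ha, by
        rw [smul_dotProduct, smul_eq_mul]; exact inv_mul_cancel₀ h0.ne'⟩
      rwa [smul_dotProduct, smul_eq_mul, le_inv_mul_iff₀ h0, mul_comm] at this
  choose N hN0 hN using hN
  have hNs : 0 ≤ ∑ j, N (e j) := Finset.sum_nonneg fun j _ => hN0 _
  obtain ⟨δ, hδ, hδN⟩ : ∃ δ : F, 0 < δ ∧ δ * ∑ j, N (e j) ≤ ε :=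
    ⟨ε * (1 + ∑ j, N (e j))⁻¹, by positivity, by
      rw [mul_assoc]
      refine mul_le_of_le_one_right hε.le ?_
      rw [inv_mul_le_iff₀ (by positivity)]; linarith⟩
  obtain ⟨_, ⟨p, hp, rfl⟩, hpx⟩ := Metric.mem_closure_iff.1 hcl δ (by exact_mod_cast hδ)
  set v := x - ε • u - p with hv
  have hvδ : ∀ j, -δ ≤ e.repr v j := by
    intro j
    have h₁ := (dist_le_pi_dist _ _ j).trans_lt hpx
    rw [Real.dist_eq, ← Pi.sub_apply, ← map_sub, ← hv, realCoord_apply] at h₁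
    exact_mod_cast (abs_lt.1 h₁).1.le
  have hxe : x = p + (∑ j, (e.repr v j + δ) • e j + (∑ j, δ • (N (e j) • u - e j) +
      (ε - δ * ∑ j, N (e j)) • u)) := by
    have h₁ : ∑ j, (e.repr v j + δ) • e j + ∑ j, δ • (N (e j) • u - e j) =
        v + (δ * ∑ j, N (e j)) • u := by
      nth_rewrite 2 [← e.sum_repr v]
      rw [Finset.mul_sum, Finset.sum_smul, ← Finset.sum_add_distrib, ← Finset.sum_add_distrib]
      exact Finset.sum_congr rfl fun j _ => by module
    rw [← add_assoc (∑ j, (e.repr v j + δ) • e j), h₁, hv]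
    module
  rw [hxe]
  refine h.add_mem hp (h.add_mem (h.sum_mem _ fun j _ => h.smul_mem ?_ (he j))
    (h.add_mem (h.sum_mem _ fun j _ => h.smul_mem hδ.le (hN _)) (h.smul_mem ?_ hu)))
  · linarith [hvδ j]
  · linarith

end IsRieszCone

end Simple

/-- Every finite subset of `P` lies in a cone generated by `finrank F V` elements of `P`. -/
def IsSimpliciallyApproximable (F : Subfield ℝ) (V : Type*) [AddCommGroup V] [Module F V]
    (P : Set V) : Prop :=
  ∀ X : Finset V, ↑X ⊆ P → ∃ (ι : Type) (_ : Fintype ι) (b : ι → V),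
    Fintype.card ι = finrank F V ∧ (∀ i, b i ∈ P) ∧
      ∀ x ∈ X, ∃ c : ι → F, (∀ i, 0 ≤ c i) ∧ x = ∑ i, c i • b i

section

variable {F : Subfield ℝ} {V : Type*} [AddCommGroup V] [Module F V] {P : Set V}

namespace IsRieszCone

open scoped Matrix in
theorem isSimpliciallyApproximable_of_simple [FiniteDimensional F V] (h : IsRieszCone F P)
    (hs : ∀ I : Submodule F V, IsOrderIdeal P I → I = ⊥ ∨ I = ⊤) :
    IsSimpliciallyApproximable F V P := by
  classical
  intro X hXP
  by_cases hP : ∀ x ∈ P, x = 0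
  · have : Subsingleton V := by
      refine subsingleton_of_forall_eq 0 fun v => ?_
      obtain ⟨a, ha, b, hb, rfl⟩ := h.directed v
      rw [hP a ha, hP b hb, sub_zero]
    exact ⟨Fin 0, inferInstance, Fin.elim0,
      (Fintype.card_fin 0).trans Module.finrank_zero_of_subsingleton.symm, fun i => i.elim0,
      fun x _ => ⟨Fin.elim0, fun i => i.elim0, Subsingleton.elim _ _⟩⟩
  push Not at hP
  obtain ⟨u, hu, hu0⟩ := hP
  have hN := h.exists_smul_sub_mem hs hu hu0
  obtain ⟨e, he⟩ := h.exists_basis_mem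
  set B := dualBase P e u with hB
  set E := B.extremePoints ℝ with hE
  have hBc : IsCompact B := isCompact_dualBase e he hN
  have hBconv : Convex ℝ B := convex_dualBase e u
  have hBne : B.Nonempty := by
    by_contra hne
    rw [Set.not_nonempty_iff_eq_empty] at hne
    refine hu0 (h.eq_zero hu (h.mem_of_forall_dualBase_pos he hu hN fun a ha => ?_))
    rw [← hB, hne] at ha
    exact ha.elim
  obtain ⟨a₀, ha₀⟩ := hBc.extremePoints_nonempty hBne
  set Y := (X.filter (· ≠ 0)).image (realCoord e) with hY
  set T : Set (Fin (finrank F V) → ℝ) := {a | ∀ y ∈ Y, 0 < a ⬝ᵥ y} with hT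
  have hBT : B ⊆ T := by
    intro a ha y hy
    obtain ⟨x, hx, rfl⟩ := Finset.mem_image.1 hy
    obtain ⟨hxX, hx0⟩ := Finset.mem_filter.1 hx
    obtain ⟨N, -, hN⟩ := h.exists_smul_sub_mem hs (hXP hxX) hx0 u
    have := le_mul_dotProduct_of_mem_dualCone ha.1 hN
    rw [ha.2] at this
    refine (ha.1 x (hXP hxX)).lt_of_ne fun h0 => ?_
    rw [← h0] at this
    linarith
  obtain ⟨s, hsT, hEs, hTs, hli⟩ := exists_linearIndepOn_id_extension
    (h.linearIndepOn_extremePoints he hu hN) (extremePoints_subset.trans hBT)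
  have hspan : ⊤ ≤ Submodule.span ℝ s := by
    rintro v -
    obtain ⟨r, hr⟩ := Finset.exists_le (Y.image fun y => (1 - v ⬝ᵥ y) / (a₀ ⬝ᵥ y))
    have ha₀T := hBT (extremePoints_subset ha₀)
    have hvr : v + r • a₀ ∈ T := by
      intro y hy
      have := hr _ (Finset.mem_image_of_mem _ hy)
      rw [div_le_iff₀ (ha₀T y hy)] at this
      rw [add_dotProduct, smul_dotProduct, smul_eq_mul]
      linarith
    rw [← add_sub_cancel_right v (r • a₀)]
    exact sub_mem (hTs hvr) (Submodule.smul_mem _ _ (hTs ha₀T))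
  have hsfin : s.Finite := LinearIndependent.setFinite hli
  have := hsfin.fintype
  let β : Basis s ℝ (Fin (finrank F V) → ℝ) := Basis.mk (v := Subtype.val) hli (by simpa using hspan)
  let σ : s ≃ Fin (finrank F V) := Fintype.equivFinOfCardEq (by
    rw [← Module.finrank_eq_card_basis β, Module.finrank_fin_fun])
  let G : Matrix (Fin (finrank F V)) (Fin (finrank F V)) ℝ := Matrix.of fun i => (σ.symm i).1
  have hG : IsUnit G.det := by
    rw [← Matrix.isUnit_iff_isUnit_det, ← Matrix.linearIndependent_rows_iff_isUnit]
    exact LinearIndependent.comp hli σ.symm σ.symm.injective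
  obtain ⟨A, hA, hGA, hAY⟩ := Matrix.exists_subfield_approx (F := F) hG Y
    fun y hy j => hsT (σ.symm j).2 y hy
  let b : Fin (finrank F V) → V := fun j => e.equivFun.symm fun i => A i j
  have hb : ∀ j, realCoord e (b j) = fun i => (A i j : ℝ) := by
    intro j; ext i
    rw [realCoord_apply, ← e.equivFun_apply, LinearEquiv.apply_symm_apply]
  refine ⟨Fin (finrank F V), inferInstance, b, by simp, fun j => ?_, fun x hx => ?_⟩
  · refine h.mem_of_forall_dualBase_pos he hu hN fun a ha => ?_
    have hEfin : E.Finite := hsfin.subset hEs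
    have hKM : convexHull ℝ E = B := by
      rw [← closure_convexHull_extremePoints hBc hBconv,
        (hEfin.isCompact_convexHull ℝ).isClosed.closure_eq]
    have hconv : Convex ℝ {a : Fin (finrank F V) → ℝ | 0 < a ⬝ᵥ realCoord e (b j)} :=
      convex_halfSpace_gt ⟨fun _ _ => add_dotProduct _ _ _, fun _ _ => smul_dotProduct _ _ _⟩ 0
    refine convexHull_min (fun a ha => ?_) hconv (by rw [hKM]; exact ha)
    have := hGA (σ ⟨a, hEs ha⟩) j
    simpa [Matrix.mul_apply, G, hb, dotProduct] using this
  · by_cases hx0 : x = 0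
    · exact ⟨0, fun _ => le_rfl, by simp [hx0]⟩
    have hxY : realCoord e x ∈ Y :=
      Finset.mem_image_of_mem _ (Finset.mem_filter.2 ⟨hx, hx0⟩)
    have hA' : IsUnit A.det := by
      have : ((A.det : F) : ℝ) = (A.map F.subtype).det := RingHom.map_det F.subtype A
      rw [isUnit_iff_ne_zero, ← this] at hA
      rw [isUnit_iff_ne_zero]
      exact fun h0 => hA (by rw [h0]; rfl)
    set c := A⁻¹ *ᵥ e.equivFun x with hc
    have hAc : A *ᵥ c = e.equivFun x := by
      rw [hc, Matrix.mulVec_mulVec, Matrix.mul_nonsing_inv A hA', Matrix.one_mulVec]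
    refine ⟨c, fun j => ?_, ?_⟩
    · have h₁ : A.map F.subtype *ᵥ (fun i => (c i : ℝ)) = realCoord e x := by
        ext i
        have := congrArg (fun f => F.subtype (f i)) hAc
        simpa [Matrix.mulVec, dotProduct, realCoord_apply] using this
      have h₂ : (fun i => (c i : ℝ)) = (A.map F.subtype)⁻¹ *ᵥ realCoord e x := by
        rw [← h₁, Matrix.mulVec_mulVec, Matrix.nonsing_inv_mul _ hA, Matrix.one_mulVec]
      have h₃ := hAY _ hxY j
      rw [← h₂] at h₃
      exact_mod_cast h₃.le
    · apply e.equivFun.injective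
      rw [← hAc, map_sum]
      funext i
      simp only [b, map_smul, LinearEquiv.apply_symm_apply, Finset.sum_apply, Pi.smul_apply,
        smul_eq_mul, Matrix.mulVec, dotProduct]
      exact Finset.sum_congr rfl fun j _ => mul_comm (A i j) (c j)

/-- The Riesz decomposition property for finite sums. -/
theorem decomp_sum (h : IsRieszCone F P) {ι : Type*} (s : Finset ι) {y : ι → V}
    (hy : ∀ i ∈ s, y i ∈ P) {x : V} (hx : x ∈ P) (hxy : ∑ i ∈ s, y i - x ∈ P) :
    ∃ z : ι → V, (∀ i ∈ s, z i ∈ P ∧ y i - z i ∈ P) ∧ x = ∑ i ∈ s, z i := by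
  classical
  induction s using Finset.induction_on generalizing x with
  | empty => exact ⟨0, by simp, h.eq_zero hx (by simpa using hxy)⟩
  | insert j s hj ih =>
    rw [Finset.sum_insert hj] at hxy
    rw [Finset.forall_mem_insert] at hy
    obtain ⟨x₁, h₁, x₂, h₂, rfl, hy₁, hy₂⟩ := h.decomp hx hy.1 (h.sum_mem s hy.2) hxy
    obtain ⟨z, hz, rfl⟩ := ih hy.2 h₂ hy₂
    have hne : ∀ i ∈ s, i ≠ j := fun i hi hij => hj (hij ▸ hi)
    refine ⟨Function.update z j x₁, ?_, ?_⟩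
    · rw [Finset.forall_mem_insert]
      refine ⟨by simpa using ⟨h₁, hy₁⟩, fun i hi => ?_⟩
      rw [Function.update_of_ne (hne i hi)]
      exact hz i hi
    · rw [Finset.sum_insert hj, Function.update_self]
      congr 1
      exact Finset.sum_congr rfl fun i hi => (Function.update_of_ne (hne i hi) _ _).symm

/-- Positive lifts modulo an ideal can be shrunk so as to be dominated by finitely many given
positive elements. -/
theorem exists_shrink (h : IsRieszCone F P) {M : Submodule F V} (hM : IsOrderIdeal P M)
    {ι : Type*} [Fintype ι] {b₀ : ι → V} (hb₀ : ∀ i, b₀ i ∈ P) {c : V → ι → F}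
    (X : Finset V) (hX : ∀ x ∈ X, x ∈ P) (hc : ∀ x ∈ X, ∀ i, 0 ≤ c x i)
    (hXM : ∀ x ∈ X, x - ∑ i, c x i • b₀ i ∈ M) :
    ∃ b : ι → V, (∀ i, b i ∈ P) ∧ (∀ i, b₀ i - b i ∈ M) ∧
      ∀ x ∈ X, x - ∑ i, c x i • b i ∈ P ∧ x - ∑ i, c x i • b i ∈ M := by
  classical
  induction X using Finset.induction_on with
  | empty => exact ⟨b₀, hb₀, fun i => by simp, by simp⟩
  | insert x X hx ih =>
    rw [Finset.forall_mem_insert] at hX hc hXM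
    obtain ⟨b, hb, hbM, hbX⟩ := ih hX.2 hc.2 hXM.2
    have hxM : x - ∑ i, c x i • b i ∈ M := by
      have : x - ∑ i, c x i • b i = (x - ∑ i, c x i • b₀ i) + ∑ i, c x i • (b₀ i - b i) := by
        simp only [smul_sub, Finset.sum_sub_distrib]; abel
      rw [this]
      exact M.add_mem hXM.1 (M.sum_mem fun i _ => M.smul_mem _ (hbM i))
    obtain ⟨p, hp, q, hq, hpM, hqM, hpq⟩ := hM.directed hxM
    obtain ⟨v, hv, w, hw, hvw, hxv, hqw⟩ := h.decomp
      (h.sum_mem Finset.univ fun i _ => h.smul_mem (hc.1 i) (hb i)) hX.1 hq (by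
        have : x + q - ∑ i, c x i • b i = p := by linear_combination (norm := module) hpq
        rwa [this])
    obtain ⟨z, hz, hwz⟩ := h.decomp_sum Finset.univ (y := fun i => c x i • b i)
      (fun i _ => h.smul_mem (hc.1 i) (hb i)) hw (by rw [hvw]; simpa)
    have hzP : ∀ i, z i ∈ P := fun i => (hz i (Finset.mem_univ i)).1
    have hzM : ∀ i, z i ∈ M := fun i => by
      refine hM.hereditary (hM.hereditary hqM hw hqw) (hzP i) ?_
      rw [hwz, ← Finset.sum_erase_add _ _ (Finset.mem_univ i), add_sub_cancel_right]
      exact h.sum_mem _ fun j _ => hzP j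
    have hcz : ∀ i, c x i • ((c x i)⁻¹ • z i) = z i := by
      intro i
      by_cases h0 : c x i = 0
      · have := (hz i (Finset.mem_univ i)).2
        rw [h0, zero_smul, zero_sub] at this
        rw [h0, zero_smul, h.eq_zero (hzP i) this]
      · rw [smul_inv_smul₀ h0]
    refine ⟨fun i => b i - (c x i)⁻¹ • z i, fun i => ?_, fun i => ?_, ?_⟩
    · by_cases h0 : c x i = 0
      · simpa [h0] using hb i
      · have := h.smul_mem (inv_nonneg.2 (hc.1 i)) (hz i (Finset.mem_univ i)).2
        rwa [smul_sub, inv_smul_smul₀ h0] at this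
    · have := M.add_mem (hbM i) (M.smul_mem (c x i)⁻¹ (hzM i))
      rwa [sub_add] at this
    · have hsub : ∀ y, y - ∑ i, c y i • (b i - (c x i)⁻¹ • z i) =
          (y - ∑ i, c y i • b i) + ∑ i, c y i • ((c x i)⁻¹ • z i) := by
        intro y
        simp only [smul_sub, Finset.sum_sub_distrib]; abel
      rw [Finset.forall_mem_insert]
      refine ⟨⟨?_, ?_⟩, fun y hy => ⟨?_, ?_⟩⟩
      · rw [hsub, Finset.sum_congr rfl fun i _ => hcz i, ← hwz, hvw]
        convert hxv using 1
        abel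
      · rw [hsub]
        exact M.add_mem hxM (M.sum_mem fun i _ => M.smul_mem _ (M.smul_mem _ (hzM i)))
      · rw [hsub]
        exact h.add_mem (hbX y hy).1 (h.sum_mem _ fun i _ => h.smul_mem (hc.2 y hy i)
          (h.smul_mem (inv_nonneg.2 (hc.1 i)) (hzP i)))
      · rw [hsub]
        exact M.add_mem (hbX y hy).2 (M.sum_mem fun i _ => M.smul_mem _ (M.smul_mem _ (hzM i)))

theorem isSimpliciallyApproximable_of_extension [FiniteDimensional F V] (h : IsRieszCone F P)
    {M : Submodule F V} (hM : IsOrderIdeal P M)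
    (h₁ : IsSimpliciallyApproximable F M (M.subtype ⁻¹' P))
    (h₂ : IsSimpliciallyApproximable F (V ⧸ M) (M.mkQ '' P)) :
    IsSimpliciallyApproximable F V P := by
  classical
  intro X hXP
  obtain ⟨ι, _, b', hcard, hb', hX'⟩ := h₂ (X.image M.mkQ) (by
    rw [Finset.coe_image]; exact Set.image_mono hXP)
  choose b₀ hb₀ hbb using hb'
  have hX'' : ∀ x, ∃ c : ι → F, x ∈ X → (∀ i, 0 ≤ c i) ∧ x - ∑ i, c i • b₀ i ∈ M := by
    intro x
    by_cases hx : x ∈ X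
    · obtain ⟨c, hc, hxc⟩ := hX' _ (Finset.mem_image_of_mem _ hx)
      refine ⟨c, fun _ => ⟨hc, ?_⟩⟩
      rw [← M.ker_mkQ, LinearMap.mem_ker, map_sub, hxc, map_sum, sub_eq_zero]
      exact Finset.sum_congr rfl fun i _ => by rw [map_smul, hbb]
    · exact ⟨0, fun hx' => absurd hx' hx⟩
  choose c hc using hX''
  obtain ⟨b, hb, -, hbX⟩ := h.exists_shrink hM hb₀ X (fun x hx => hXP hx)
    (fun x hx => (hc x hx).1) (fun x hx => (hc x hx).2)
  obtain ⟨κ, _, m, hcard', hm, hmX⟩ := h₁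
    (X.attach.image fun x : {x // x ∈ X} =>
      (⟨x.1 - ∑ i, c x.1 i • b i, (hbX x.1 x.2).2⟩ : M)) (by
      intro y hy
      obtain ⟨x, -, rfl⟩ := Finset.mem_image.1 (Finset.mem_coe.1 hy)
      exact (hbX x.1 x.2).1)
  refine ⟨ι ⊕ κ, inferInstance, Sum.elim b fun k => (m k : V), ?_, ?_, fun x hx => ?_⟩
  · rw [Fintype.card_sum, hcard, hcard', M.finrank_quotient_add_finrank]
  · rintro (i | k)
    exacts [hb i, hm k]
  · obtain ⟨d, hd, hxd⟩ := hmX _ (Finset.mem_image_of_mem _ (Finset.mem_attach X ⟨x, hx⟩))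
    refine ⟨Sum.elim (c x) d, ?_, ?_⟩
    · rintro (i | k)
      exacts [(hc x hx).1 i, hd k]
    · have := congrArg M.subtype hxd
      rw [Fintype.sum_sum_type]
      simp only [Submodule.subtype_apply, Submodule.coe_sum, Submodule.coe_smul] at this
      simp only [Sum.elim_inl, Sum.elim_inr]
      rw [← this]
      abel

end IsRieszCone

end

theorem IsRieszCone.isSimpliciallyApproximable {F : Subfield ℝ} {V : Type u} [AddCommGroup V]
    [Module F V] [FiniteDimensional F V] {P : Set V} (h : IsRieszCone F P) :
    IsSimpliciallyApproximable F V P :=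
  IsRieszCone.induction (motive := fun V _ _ P => IsSimpliciallyApproximable F V P)
    (fun _ _ _ _ _ h hs => h.isSimpliciallyApproximable_of_simple hs)
    (fun _ _ _ _ _ _ h hM => h.isSimpliciallyApproximable_of_extension hM) V P h

theorem IsRieszCone.exists_basis_repr_nonneg {F : Subfield ℝ} {V : Type u} [AddCommGroup V]
    [Module F V] [FiniteDimensional F V] {P : Set V} (h : IsRieszCone F P) (X : Finset V)
    (hX : ↑X ⊆ P) : ∃ b : Basis (Fin (finrank F V)) F V, (∀ i, b i ∈ P) ∧
      ∀ x ∈ X, ∀ i, 0 ≤ b.repr x i := by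
  classical
  obtain ⟨e, he⟩ := h.exists_basis_mem
  obtain ⟨ι, _, b, hcard, hb, hbX⟩ := h.isSimpliciallyApproximable
    (X ∪ Finset.univ.image e) (by
      intro x hx
      rcases Finset.mem_union.1 (Finset.mem_coe.1 hx) with hx | hx
      · exact hX hx
      · obtain ⟨i, -, rfl⟩ := Finset.mem_image.1 hx
        exact he i)
  have hspan : ⊤ ≤ Submodule.span F (Set.range b) := by
    rw [← e.span_eq, Submodule.span_le]
    rintro _ ⟨i, rfl⟩
    obtain ⟨c, -, hc⟩ := hbX (e i)
      (Finset.mem_union_right _ (Finset.mem_image_of_mem _ (Finset.mem_univ i)))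
    rw [hc]
    exact Submodule.sum_mem _ fun j _ =>
      Submodule.smul_mem _ _ (Submodule.subset_span (Set.mem_range_self j))
  let β := basisOfTopLeSpanOfCardEqFinrank b hspan hcard
  have hβ : ⇑β = b := coe_basisOfTopLeSpanOfCardEqFinrank b hspan hcard
  refine ⟨β.reindex (Fintype.equivFinOfCardEq hcard), fun i => ?_, fun x hx i => ?_⟩
  · rw [Basis.reindex_apply, hβ]; exact hb _
  · obtain ⟨c, hc, rfl⟩ := hbX x (Finset.mem_union_left _ hx)
    rw [Basis.repr_reindex_apply, ← hβ, β.repr_sum_self]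
    exact hc _

/-- Every `n`-dimensional ordered directed vector space `(V, P)` over a subfield `F` of `ℝ`
with Riesz interpolation is the inductive limit of a sequence with all finite stages
`(Fⁿ, F_{≥0}ⁿ)`: concretely, there exist bijective linear maps `φ i : Fⁿ → V` with nested
images of the positive orthant whose union is `P`. -/
theorem stmt15 (F : Subfield ℝ) (V : Type*) [AddCommGroup V] [Module F V]
    (n : ℕ) [FiniteDimensional F V] (hdim : Module.finrank F V = n)
    (P : Set V)
    (h0 : P ∩ (-P) = {0})
    (hadd : ∀ x ∈ P, ∀ y ∈ P, x + y ∈ P)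
    (hsmul : ∀ c : F, 0 ≤ c → ∀ x ∈ P, c • x ∈ P)
    (hdir : ∀ v : V, ∃ a ∈ P, ∃ b ∈ P, v = a - b)
    (hinterp : ∀ a₁ a₂ c₁ c₂ : V,
      c₁ - a₁ ∈ P → c₁ - a₂ ∈ P → c₂ - a₁ ∈ P → c₂ - a₂ ∈ P →
      ∃ b : V, b - a₁ ∈ P ∧ b - a₂ ∈ P ∧ c₁ - b ∈ P ∧ c₂ - b ∈ P) :
    ∃ φ : ℕ → ((Fin n → F) →ₗ[F] V),
      (∀ i, Function.Bijective (φ i)) ∧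
      (∀ i, φ i '' {z : Fin n → F | ∀ j, 0 ≤ z j} ⊆
        φ (i + 1) '' {z : Fin n → F | ∀ j, 0 ≤ z j}) ∧
      P = ⋃ i, φ i '' {z : Fin n → F | ∀ j, 0 ≤ z j} := by
  classical
  subst hdim
  have hzero : (0 : V) ∈ P := (h0.symm ▸ Set.mem_singleton (0 : V) : (0 : V) ∈ P ∩ -P).1
  have h : IsRieszCone F P :=
    { zero_mem := hzero
      add_mem := fun hx hy => hadd _ hx _ hy
      smul_mem := fun hc hx => hsmul _ hc _ hx
      eq_zero := fun {x} hx hx' => by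
        have : x ∈ P ∩ -P := ⟨hx, hx'⟩
        rwa [h0] at this
      directed := hdir
      decomp := by
        intro x y z hx hy hz hxyz
        have hyz : y - (x - z) = y + z - x := by abel
        obtain ⟨b, hb, hb', hxb, hyb⟩ := hinterp 0 (x - z) x y (by simpa) (by simpa) (by simpa)
          (by rwa [hyz])
        refine ⟨b, by simpa using hb, x - b, hxb, by abel, hyb, ?_⟩
        convert hb' using 1
        abel }
  obtain ⟨s, hs, hgen⟩ := h.exists_generating_seq
  obtain ⟨step, hstep⟩ : ∃ step : (ℕ × {b : Basis (Fin (finrank F V)) F V // ∀ i, b i ∈ P}) →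
      {b : Basis (Fin (finrank F V)) F V // ∀ i, b i ∈ P}, ∀ p,
      (∀ i, 0 ≤ (step p).1.repr (s p.1) i) ∧ ∀ j i, 0 ≤ (step p).1.repr (p.2.1 j) i := by
    have : ∀ p : ℕ × {b : Basis (Fin (finrank F V)) F V // ∀ i, b i ∈ P},
        ∃ b : {b : Basis (Fin (finrank F V)) F V // ∀ i, b i ∈ P},
        (∀ i, 0 ≤ b.1.repr (s p.1) i) ∧ ∀ j i, 0 ≤ b.1.repr (p.2.1 j) i := by
      intro p
      obtain ⟨b, hb, hbX⟩ := h.exists_basis_repr_nonneg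
        (insert (s p.1) (Finset.univ.image p.2.1)) (by
          intro x hx
          rcases Finset.mem_insert.1 (Finset.mem_coe.1 hx) with rfl | hx
          · exact hs _
          · obtain ⟨i, -, rfl⟩ := Finset.mem_image.1 hx
            exact p.2.2 i)
      exact ⟨⟨b, hb⟩, hbX _ (Finset.mem_insert_self _ _), fun j => hbX _
        (Finset.mem_insert_of_mem (Finset.mem_image_of_mem _ (Finset.mem_univ j)))⟩
    choose step hstep using this
    exact ⟨step, hstep⟩
  obtain ⟨e, he⟩ := h.exists_basis_mem
  let b : ℕ → {b : Basis (Fin (finrank F V)) F V // ∀ i, b i ∈ P} :=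
    fun k => Nat.rec ⟨e, he⟩ (fun k b => step (k, b)) k
  have himage : ∀ k, ((b k).1.equivFun.symm : (Fin (finrank F V) → F) →ₗ[F] V) ''
      {z | ∀ j, 0 ≤ z j} = {x | ∀ j, 0 ≤ (b k).1.repr x j} := by
    intro k
    ext x
    constructor
    · rintro ⟨z, hz, rfl⟩ j
      have : (b k).1.equivFun ((b k).1.equivFun.symm z) j = z j := by
        rw [LinearEquiv.apply_symm_apply]
      rw [Basis.equivFun_apply] at this
      exact this ▸ hz j
    · intro hx
      exact ⟨(b k).1.equivFun x, hx, (b k).1.equivFun.symm_apply_apply x⟩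
  have hmono : Monotone fun k => {x | ∀ j, 0 ≤ (b k).1.repr x j} := by
    refine monotone_nat_of_le_succ fun k x hx j => ?_
    rw [← (b k).1.sum_repr x, map_sum, Finsupp.finsetSum_apply]
    refine Finset.sum_nonneg fun i _ => ?_
    rw [map_smul, Finsupp.smul_apply, smul_eq_mul]
    exact mul_nonneg (hx i) ((hstep (k, b k)).2 i j)
  refine ⟨fun k => (b k).1.equivFun.symm, fun k => (b k).1.equivFun.symm.bijective,
    fun k => ?_, ?_⟩
  · beta_reduce
    rw [himage k, himage (k + 1)]
    exact hmono k.le_succ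
  · simp only [himage]
    refine Set.Subset.antisymm (hgen _ (fun i => ?_) ?_ ?_) (Set.iUnion_subset fun k x hx => ?_)
    · exact Set.mem_iUnion.2 ⟨i + 1, (hstep (i, b i)).1⟩
    · intro x hx y hy
      obtain ⟨i, hi⟩ := Set.mem_iUnion.1 hx
      obtain ⟨k, hk⟩ := Set.mem_iUnion.1 hy
      refine Set.mem_iUnion.2 ⟨max i k, fun j => ?_⟩
      rw [map_add, Finsupp.add_apply]
      exact add_nonneg (hmono (le_max_left i k) hi j) (hmono (le_max_right i k) hk j)
    · intro c hc x hx
      obtain ⟨i, hi⟩ := Set.mem_iUnion.1 hx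
      refine Set.mem_iUnion.2 ⟨i, fun j => ?_⟩
      rw [map_smul, Finsupp.smul_apply, smul_eq_mul]
      exact mul_nonneg hc (hi j)
    · rw [← (b k).1.sum_repr x]
      exact h.sum_mem _ fun i _ => h.smul_mem (hx i) ((b k).2 i)
end

section
/- Every n-dimensional ordered directed ℚ-vector space (V, V⁺) with Riesz interpolation is isomorphic, as an ordered abelian group, to the inductive limit of a sequence of ordered groups (ℤⁿ, ℤ_{≥0}ⁿ) → (ℤⁿ, ℤ_{≥0}ⁿ) → ⋯ with positivity-preserving group homomorphisms. -/
/-- The composite connecting map from stage `i` to stage `i + k`. -/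
def iterA (n : ℕ) (φ : ℕ → ((Fin n → ℤ) →+ (Fin n → ℤ))) :
    ℕ → ℕ → ((Fin n → ℤ) →+ (Fin n → ℤ))
  | _, 0 => AddMonoidHom.id _
  | i, k + 1 => (φ (i + k)).comp (iterA n φ i k)

/-- The positive cone of a directed partially ordered `ℚ`-vector space with the Riesz
decomposition property. -/
structure RieszCone {V : Type*} [AddCommGroup V] [Module ℚ V] (P : Set V) : Prop where
  zero_mem : (0 : V) ∈ P
  pointed : ∀ x ∈ P, -x ∈ P → x = 0
  add_mem : ∀ x ∈ P, ∀ y ∈ P, x + y ∈ P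
  smul_mem : ∀ c : ℚ, 0 ≤ c → ∀ x ∈ P, c • x ∈ P
  directed : ∀ v : V, ∃ a ∈ P, ∃ b ∈ P, v = a - b
  decomp : ∀ x ∈ P, ∀ y ∈ P, ∀ z ∈ P, y + z - x ∈ P →
    ∃ x₁ ∈ P, ∃ x₂ ∈ P, x = x₁ + x₂ ∧ y - x₁ ∈ P ∧ z - x₂ ∈ P

/-- Every finite subset of `P` lies in the cone generated by a linearly independent family
in `P`. -/
def HasSimplicialCovers {V : Type*} [AddCommGroup V] [Module ℚ V] (P : Set V) : Prop :=
  ∀ F : Set V, F.Finite → F ⊆ P → ∃ (ι : Type) (_ : Fintype ι) (b : ι → V),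
    LinearIndependent ℚ b ∧ (∀ i, b i ∈ P) ∧
      ∀ f ∈ F, ∃ c : ι → ℚ, (∀ i, 0 ≤ c i) ∧ f = ∑ i, c i • b i

/-- A directed hereditary subspace of `(V, P)`. -/
structure IsOrderIdeal_s17 {V : Type*} [AddCommGroup V] [Module ℚ V] (P : Set V)
    (I : Submodule ℚ V) : Prop where
  directed : ∀ v ∈ I, ∃ a ∈ P, ∃ b ∈ P, a ∈ I ∧ b ∈ I ∧ v = a - b
  hereditary : ∀ x ∈ P, ∀ y ∈ I, y - x ∈ P → x ∈ I

section Cone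

variable {V : Type*} [AddCommGroup V] [Module ℚ V] {P : Set V} {I : Submodule ℚ V}

namespace RieszCone

theorem sum_mem (h : RieszCone P) {ι : Type*} (s : Finset ι) (x : ι → V)
    (hx : ∀ i ∈ s, x i ∈ P) : ∑ i ∈ s, x i ∈ P :=
  Finset.sum_induction x (· ∈ P) (fun a b ha hb => h.add_mem a ha b hb) h.zero_mem hx

theorem interpolation (h : RieszCone P) {a₁ a₂ c₁ c₂ : V} (h₁₁ : c₁ - a₁ ∈ P)
    (h₁₂ : c₁ - a₂ ∈ P) (h₂₁ : c₂ - a₁ ∈ P) (h₂₂ : c₂ - a₂ ∈ P) :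
    ∃ b : V, b - a₁ ∈ P ∧ b - a₂ ∈ P ∧ c₁ - b ∈ P ∧ c₂ - b ∈ P := by
  obtain ⟨x, hx, y, hy, hxy, hx', hy'⟩ := h.decomp _ h₁₁ _ h₁₂ _ h₂₁
    (by convert h₂₂ using 1; abel)
  refine ⟨a₁ + y, by simpa using hy, ?_, ?_, ?_⟩
  · have : a₁ + y - a₂ = c₁ - a₂ - x := by
      rw [eq_sub_iff_add_eq.2 (show y + x = c₁ - a₁ by rw [hxy, add_comm])]; abel
    rwa [this]
  · have : c₁ - (a₁ + y) = x := by
      rw [eq_sub_iff_add_eq.2 (show y + x = c₁ - a₁ by rw [hxy, add_comm])]; abel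
    rwa [this]
  · convert hy' using 1; abel

theorem decomp_sum (h : RieszCone P) {ι : Type*} (s : Finset ι) (y : ι → V)
    (hy : ∀ i ∈ s, y i ∈ P) :
    ∀ x ∈ P, ∑ i ∈ s, y i - x ∈ P →
      ∃ z : ι → V, x = ∑ i ∈ s, z i ∧ ∀ i ∈ s, z i ∈ P ∧ y i - z i ∈ P := by
  classical
  induction s using Finset.induction_on with
  | empty =>
    intro x hx hx'
    exact ⟨0, by simpa using h.pointed x hx (by simpa using hx'), by simp⟩
  | insert a s ha ih =>
    intro x hx hx'
    rw [Finset.sum_insert ha] at hx'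
    obtain ⟨x₁, h₁, x₂, h₂, rfl, h₁', h₂'⟩ := h.decomp x hx _ (hy a (by simp)) _
      (h.sum_mem s y fun i hi => hy i (by simp [hi])) hx'
    obtain ⟨z, rfl, hz⟩ := ih (fun i hi => hy i (by simp [hi])) x₂ h₂ h₂'
    have hne : ∀ i ∈ s, i ≠ a := fun i hi e => ha (e ▸ hi)
    refine ⟨Function.update z a x₁, ?_, ?_⟩
    · rw [Finset.sum_insert ha, Function.update_self]
      congr 1
      exact Finset.sum_congr rfl fun i hi => (Function.update_of_ne (hne i hi) _ _).symm
    · intro i hi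
      rcases Finset.mem_insert.1 hi with rfl | hi
      · simpa using ⟨h₁, h₁'⟩
      · simpa [Function.update_of_ne (hne i hi)] using hz i hi

theorem ideal (h : RieszCone P) (hI : IsOrderIdeal_s17 P I) :
    RieszCone ((↑) ⁻¹' P : Set I) where
  zero_mem := h.zero_mem
  pointed x hx hx' := Subtype.ext (h.pointed x hx hx')
  add_mem x hx y hy := h.add_mem x hx y hy
  smul_mem c hc x hx := h.smul_mem c hc x hx
  directed v := by
    obtain ⟨a, ha, b, hb, haI, hbI, hv⟩ := hI.directed v v.2
    exact ⟨⟨a, haI⟩, ha, ⟨b, hbI⟩, hb, Subtype.ext hv⟩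
  decomp x hx y hy z hz hxyz := by
    obtain ⟨x₁, h₁, x₂, h₂, e, h₁', h₂'⟩ := h.decomp x hx y hy z hz hxyz
    exact ⟨⟨x₁, hI.hereditary _ h₁ _ y.2 h₁'⟩, h₁, ⟨x₂, hI.hereditary _ h₂ _ z.2 h₂'⟩, h₂,
      Subtype.ext e, h₁', h₂'⟩

theorem quotient (h : RieszCone P) (hI : IsOrderIdeal_s17 P I) :
    RieszCone (I.mkQ '' P) where
  zero_mem := ⟨0, h.zero_mem, map_zero _⟩
  pointed := by
    rintro _ ⟨x, hx, rfl⟩ ⟨y, hy, hxy⟩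
    have hmem : x + y ∈ I := by
      rw [← Submodule.ker_mkQ I, LinearMap.mem_ker, map_add, hxy, add_neg_cancel]
    have : x ∈ I := hI.hereditary x hx _ hmem (by simpa using hy)
    simpa using this
  add_mem := by
    rintro _ ⟨x, hx, rfl⟩ _ ⟨y, hy, rfl⟩
    exact ⟨x + y, h.add_mem x hx y hy, map_add _ _ _⟩
  smul_mem := by
    rintro c hc _ ⟨x, hx, rfl⟩
    exact ⟨c • x, h.smul_mem c hc x hx, map_smul _ _ _⟩
  directed v := by
    obtain ⟨v, rfl⟩ := I.mkQ_surjective v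
    obtain ⟨a, ha, b, hb, rfl⟩ := h.directed v
    exact ⟨_, ⟨a, ha, rfl⟩, _, ⟨b, hb, rfl⟩, map_sub _ _ _⟩
  decomp := by
    rintro _ ⟨x, hx, rfl⟩ _ ⟨y, hy, rfl⟩ _ ⟨z, hz, rfl⟩ ⟨p, hp, hpe⟩
    have hmem : y + z - x - p ∈ I := by
      rw [← Submodule.ker_mkQ I, LinearMap.mem_ker, map_sub, hpe]; simp
    obtain ⟨a, ha, b, hb, haI, hbI, e⟩ := hI.directed _ hmem
    have key : y + (z + b) - x ∈ P := by
      have : y + (z + b) - x = a + p := by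
        have : y + z - x = a - b + p := by rw [← e]; abel
        calc y + (z + b) - x = (y + z - x) + b := by abel
          _ = _ := by rw [this]; abel
      rw [this]; exact h.add_mem a ha p hp
    obtain ⟨x₁, h₁, x', h', rfl, h₁', h''⟩ := h.decomp x hx y hy _ (h.add_mem z hz b hb) key
    obtain ⟨x₂, h₂, x₃, h₃, rfl, h₂', h₃'⟩ := h.decomp x' h' z hz b hb h''
    have h₃I : I.mkQ x₃ = 0 := by simpa using hI.hereditary x₃ h₃ b hbI h₃'
    exact ⟨_, ⟨x₁, h₁, rfl⟩, _, ⟨x₂, h₂, rfl⟩, by simp [h₃I, map_add],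
      ⟨_, h₁', map_sub _ _ _⟩, ⟨_, h₂', map_sub _ _ _⟩⟩

/-- The elements of an order ideal lying in an order interval `[0, c]` form an upward directed
set. -/
theorem exists_upper_bound (h : RieszCone P) (hI : IsOrderIdeal_s17 P I) {c : V} (hc : c ∈ P)
    {T : Set V} (hT : T.Finite) (hTc : ∀ x ∈ T, x ∈ P ∧ x ∈ I ∧ c - x ∈ P) :
    ∃ d ∈ P, d ∈ I ∧ c - d ∈ P ∧ ∀ x ∈ T, d - x ∈ P := by
  induction T, hT using Set.Finite.induction_on with
  | empty => exact ⟨0, h.zero_mem, I.zero_mem, by simpa using hc, by simp⟩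
  | @insert a T _ _ ih =>
    obtain ⟨d, hd, hdI, hdc, hdT⟩ := ih fun x hx => hTc x (by simp [hx])
    obtain ⟨ha, haI, hac⟩ := hTc a (by simp)
    obtain ⟨e, hea, hed, hec, heu⟩ := h.interpolation (a₁ := a) (a₂ := d) (c₁ := c)
      (c₂ := a + d) hac hdc (by simpa using hd) (by simpa using ha)
    have he : e ∈ P := by simpa using h.add_mem _ hea _ ha
    refine ⟨e, he, hI.hereditary e he _ (I.add_mem haI hdI) heu, hec, ?_⟩
    rintro x (rfl | hx)
    · exact hea
    · simpa using h.add_mem _ hed _ (hdT x hx)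

/-- A positive element congruent modulo an order ideal to a nonnegative combination of positive
elements `c j` becomes larger than that combination once the `c j` are suitably lowered. -/
theorem exists_lowering (h : RieszCone P) (hI : IsOrderIdeal_s17 P I) {ι : Type*} [Fintype ι]
    {c : ι → V} (hc : ∀ i, c i ∈ P) {t : ι → ℚ} (ht : ∀ i, 0 ≤ t i) {f : V} (hf : f ∈ P)
    (hfI : f - ∑ i, t i • c i ∈ I) :
    ∃ d : ι → V, (∀ i, d i ∈ P ∧ d i ∈ I ∧ c i - d i ∈ P) ∧
      f - ∑ i, t i • (c i - d i) ∈ P := by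
  classical
  obtain ⟨a, ha, b, hb, haI, hbI, e⟩ := hI.directed _ hfI
  have hsum : ∑ i, t i • c i ∈ P := h.sum_mem _ _ fun i _ => h.smul_mem _ (ht i) _ (hc i)
  obtain ⟨r, hr0, hr, hrs, hrb⟩ := h.interpolation (a₁ := 0) (a₂ := b - a)
    (c₁ := ∑ i, t i • c i) (c₂ := b) (by simpa using hsum)
    (by
      have : ∑ i, t i • c i - (b - a) = f := by
        rw [← neg_sub a b, ← e]; abel
      rwa [this])
    (by simpa using hb) (by simpa using ha)
  rw [sub_zero] at hr0
  have hrI : r ∈ I := hI.hereditary r hr0 b hbI hrb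
  obtain ⟨z, rfl, hz⟩ := h.decomp_sum Finset.univ (fun i => t i • c i)
    (fun i _ => h.smul_mem _ (ht i) _ (hc i)) r hr0 hrs
  have hzI : ∀ i, z i ∈ I := fun i => hI.hereditary _ (hz i (Finset.mem_univ i)).1 _ hrI (by
    rw [← Finset.sum_erase_eq_sub (Finset.mem_univ i)]
    exact h.sum_mem _ _ fun j _ => (hz j (Finset.mem_univ j)).1)
  have hz0 : ∀ i, t i = 0 → z i = 0 := fun i hi => by
    obtain ⟨h1, h2⟩ := hz i (Finset.mem_univ i)
    exact h.pointed _ h1 (by simpa [hi] using h2)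
  refine ⟨fun i => (t i)⁻¹ • z i, fun i => ⟨?_, ?_, ?_⟩, ?_⟩
  · exact h.smul_mem _ (inv_nonneg.2 (ht i)) _ (hz i (Finset.mem_univ i)).1
  · exact I.smul_mem _ (hzI i)
  · rcases eq_or_ne (t i) 0 with hi | hi
    · simpa [hi] using hc i
    · have := h.smul_mem _ (inv_nonneg.2 (ht i)) _ (hz i (Finset.mem_univ i)).2
      rwa [smul_sub, smul_smul, inv_mul_cancel₀ hi, one_smul] at this
  · have : ∑ i, t i • (c i - (t i)⁻¹ • z i) = ∑ i, t i • c i - ∑ i, z i := by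
      rw [← Finset.sum_sub_distrib]
      refine Finset.sum_congr rfl fun i _ => ?_
      rcases eq_or_ne (t i) 0 with hi | hi
      · simp [hi, hz0 i hi]
      · rw [smul_sub, smul_smul, mul_inv_cancel₀ hi, one_smul]
    rw [this]
    convert hr using 1
    rw [← neg_sub a b, ← e]; abel

theorem hasSimplicialCovers_of_ideal (h : RieszCone P) (hI : IsOrderIdeal_s17 P I)
    (h₁ : HasSimplicialCovers ((↑) ⁻¹' P : Set I)) (h₂ : HasSimplicialCovers (I.mkQ '' P)) :
    HasSimplicialCovers P := by
  intro F hF hFP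
  obtain ⟨ι, _, cq, hli, hcq, hFq⟩ := h₂ (I.mkQ '' F) (hF.image _) (Set.image_mono hFP)
  choose c hc hcc using hcq
  have hex : ∀ f : V, ∃ (t : ι → ℚ) (d : ι → V), f ∈ F → (∀ i, 0 ≤ t i) ∧
      f - ∑ i, t i • c i ∈ I ∧ (∀ i, d i ∈ P ∧ d i ∈ I ∧ c i - d i ∈ P) ∧
      f - ∑ i, t i • (c i - d i) ∈ P := by
    intro f
    by_cases hf : f ∈ F
    · obtain ⟨t, ht, hft⟩ := hFq _ ⟨f, hf, rfl⟩
      have hfI : f - ∑ i, t i • c i ∈ I := by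
        rw [← Submodule.ker_mkQ I, LinearMap.mem_ker, map_sub, hft, map_sum]
        simp only [map_smul, hcc, sub_self]
      obtain ⟨d, hd, hd'⟩ := h.exists_lowering hI hc ht (hFP hf) hfI
      exact ⟨t, d, fun _ => ⟨ht, hfI, hd, hd'⟩⟩
    · exact ⟨0, 0, fun h => (hf h).elim⟩
  choose t d htd using hex
  have hub : ∀ i, ∃ e ∈ P, e ∈ I ∧ c i - e ∈ P ∧ ∀ x ∈ (fun f => d f i) '' F, e - x ∈ P := by
    intro i
    refine h.exists_upper_bound hI (hc i) (hF.image _) ?_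
    rintro _ ⟨f, hf, rfl⟩
    exact (htd f hf).2.2.1 i
  choose e he heI hce hed using hub
  have hmem : ∀ f ∈ F, f - ∑ i, t f i • (c i - e i) ∈ I ∧
      f - ∑ i, t f i • (c i - e i) ∈ P := by
    intro f hf
    obtain ⟨ht, hfI, hd, hd'⟩ := htd f hf
    constructor
    · have : f - ∑ i, t f i • (c i - e i) = f - ∑ i, t f i • c i + ∑ i, t f i • e i := by
        simp only [smul_sub, Finset.sum_sub_distrib]; abel
      rw [this]
      exact I.add_mem hfI (I.sum_mem fun i _ => I.smul_mem _ (heI i))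
    · have : f - ∑ i, t f i • (c i - e i) =
          f - ∑ i, t f i • (c i - d f i) + ∑ i, t f i • (e i - d f i) := by
        simp only [smul_sub, Finset.sum_sub_distrib]; abel
      rw [this]
      exact h.add_mem _ hd' _ (h.sum_mem _ _ fun i _ =>
        h.smul_mem _ (ht i) _ (hed i _ ⟨f, hf, rfl⟩))
  obtain ⟨κ, _, g, hg, hgP, hgG⟩ := h₁
    ((↑) ⁻¹' ((fun f => f - ∑ i, t f i • (c i - e i)) '' F))
    ((hF.image _).preimage Subtype.val_injective.injOn)
    (by
      rintro x ⟨f, hf, hx⟩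
      change (x : V) ∈ P
      rw [← hx]; exact (hmem f hf).2)
  refine ⟨κ ⊕ ι, inferInstance, Sum.elim (fun k => (g k : V)) (fun i => c i - e i),
    LinearIndependent.sumElim_of_quotient hg _ ?_, ?_, ?_⟩
  · have hmk : (Submodule.Quotient.mk (p := I) ∘ fun i => c i - e i) = cq := by
      funext i
      rw [← hcc i]
      change I.mkQ (c i - e i) = _
      rw [map_sub, sub_eq_self]
      simpa using heI i
    rw [hmk]
    exact hli
  · rintro (k | i)
    · exact hgP k
    · exact hce i
  · intro f hf
    obtain ⟨s, hs, hfs⟩ := hgG ⟨_, (hmem f hf).1⟩ ⟨f, hf, rfl⟩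
    refine ⟨Sum.elim s (t f), ?_, ?_⟩
    · rintro (k | i)
      · exact hs k
      · exact (htd f hf).1 i
    · have := congrArg Subtype.val hfs
      simp only [Submodule.coe_sum, Submodule.coe_smul] at this
      rw [Fintype.sum_sum_type]
      simp only [Sum.elim_inl, Sum.elim_inr]
      rw [← this]; abel

/-- The order ideal generated by a positive element. -/
def principalIdeal (h : RieszCone P) (u : V) : Submodule ℚ V where
  carrier := {v | ∃ t : ℚ, 0 ≤ t ∧ t • u - v ∈ P ∧ t • u + v ∈ P}
  zero_mem' := ⟨0, le_rfl, by simpa using h.zero_mem, by simpa using h.zero_mem⟩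
  add_mem' := by
    rintro x y ⟨s, hs, hs₁, hs₂⟩ ⟨t, ht, ht₁, ht₂⟩
    refine ⟨s + t, add_nonneg hs ht, ?_, ?_⟩
    · convert h.add_mem _ hs₁ _ ht₁ using 1; rw [add_smul]; abel
    · convert h.add_mem _ hs₂ _ ht₂ using 1; rw [add_smul]; abel
  smul_mem' := by
    rintro c x ⟨s, hs, hs₁, hs₂⟩
    refine ⟨|c| * s, mul_nonneg (abs_nonneg c) hs, ?_⟩
    rcases le_total 0 c with hc | hc
    · rw [abs_of_nonneg hc, mul_smul, ← smul_sub, ← smul_add]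
      exact ⟨h.smul_mem c hc _ hs₁, h.smul_mem c hc _ hs₂⟩
    · have hc' : 0 ≤ -c := neg_nonneg.2 hc
      rw [abs_of_nonpos hc, mul_smul]
      constructor
      · convert h.smul_mem _ hc' _ hs₂ using 1; rw [smul_add, neg_smul c x]; abel
      · convert h.smul_mem _ hc' _ hs₁ using 1; rw [smul_sub, neg_smul c x]; abel

theorem isOrderIdeal_principalIdeal (h : RieszCone P) {u : V} (hu : u ∈ P) :
    IsOrderIdeal_s17 P (h.principalIdeal u) where
  directed := by
    rintro v ⟨t, ht, h₁, h₂⟩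
    have hu' : u ∈ h.principalIdeal u :=
      ⟨1, zero_le_one, by simpa using h.zero_mem, by simpa using h.add_mem u hu u hu⟩
    exact ⟨_, h₂, _, h.smul_mem t ht u hu,
      (h.principalIdeal u).add_mem ((h.principalIdeal u).smul_mem t hu') ⟨t, ht, h₁, h₂⟩,
      (h.principalIdeal u).smul_mem t hu', by abel⟩
  hereditary := by
    rintro x hx y ⟨t, ht, h₁, -⟩ hyx
    exact ⟨t, ht, by simpa using h.add_mem _ h₁ _ hyx,
      h.add_mem _ (h.smul_mem t ht u hu) _ hx⟩

end RieszCone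

end Cone

section Functionals

open Module Pointwise

variable {V : Type*} [AddCommGroup V] [Module ℚ V] {P : Set V} {n : ℕ}

/-- Evaluation at `v` of the additive functional `V → ℝ` whose values on the basis `β` are
given. -/
noncomputable def evalCoord (β : Basis (Fin n) ℚ V) (v : V) : (Fin n → ℝ) →L[ℝ] ℝ :=
  ∑ j, (β.repr v j : ℝ) • ContinuousLinearMap.proj j

theorem evalCoord_apply (β : Basis (Fin n) ℚ V) (v : V) (w : Fin n → ℝ) :
    evalCoord β v w = ∑ j, (β.repr v j : ℝ) * w j := by
  simp [evalCoord]

theorem evalCoord_add (β : Basis (Fin n) ℚ V) (x y : V) (w : Fin n → ℝ) :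
    evalCoord β (x + y) w = evalCoord β x w + evalCoord β y w := by
  simp [evalCoord_apply, add_mul, Finset.sum_add_distrib]

theorem evalCoord_smul (β : Basis (Fin n) ℚ V) (c : ℚ) (x : V) (w : Fin n → ℝ) :
    evalCoord β (c • x) w = c * evalCoord β x w := by
  simp [evalCoord_apply, mul_assoc, Finset.mul_sum]

theorem evalCoord_zero (β : Basis (Fin n) ℚ V) (w : Fin n → ℝ) :
    evalCoord β 0 w = 0 := by
  simp [evalCoord_apply]

theorem evalCoord_sub (β : Basis (Fin n) ℚ V) (x y : V) (w : Fin n → ℝ) :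
    evalCoord β (x - y) w = evalCoord β x w - evalCoord β y w := by
  simp [evalCoord_apply, sub_mul, Finset.sum_sub_distrib]

theorem evalCoord_basis (β : Basis (Fin n) ℚ V) (j : Fin n) (w : Fin n → ℝ) :
    evalCoord β (β j) w = w j := by
  simp [evalCoord_apply, Finsupp.single_apply, apply_ite (Rat.cast : ℚ → ℝ)]

theorem exists_evalCoord_eq (β : Basis (Fin n) ℚ V) (L : V →+ ℝ) :
    ∃ w, ∀ v, evalCoord β v w = L v := by
  refine ⟨fun j => L (β j), fun v => ?_⟩
  have h : ∀ x, L x = L.toRatLinearMap x := fun _ => rfl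
  conv_rhs => rw [← β.sum_repr v, h, map_sum]
  simp [evalCoord_apply, Rat.smul_def]

/-- A rational cone with an order unit `u` not containing `-u` has a state. -/
theorem exists_positive_functional (β : Basis (Fin n) ℚ V) {Q : Set V} {u : V}
    (hadd : ∀ x ∈ Q, ∀ y ∈ Q, x + y ∈ Q) (hsmul : ∀ c : ℚ, 0 ≤ c → ∀ x ∈ Q, c • x ∈ Q)
    (hu : u ∈ Q) (hunit : ∀ v, ∃ t : ℚ, 0 ≤ t ∧ t • u - v ∈ Q) (hnu : -u ∉ Q) :
    ∃ w, (∀ q ∈ Q, 0 ≤ evalCoord β q w) ∧ 0 < evalCoord β u w := by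
  have hzero : (0 : V) ∈ Q := by simpa using hsmul 0 le_rfl u hu
  let emb : V →+ (Fin n → ℝ) :=
    { toFun := fun v j => (β.repr v j : ℝ)
      map_zero' := by ext; simp
      map_add' := fun x y => by ext; simp }
  have hemb : ∀ (c : ℚ) x, emb (c • x) = (c : ℝ) • emb x := by
    intro c x; ext j; simp [emb]
  set A := closure (emb '' Q) with hA
  have hAadd : ∀ x ∈ A, ∀ y ∈ A, x + y ∈ A := by
    intro x hx y hy
    refine map_mem_closure₂ continuous_add hx hy ?_
    rintro _ ⟨x, hx, rfl⟩ _ ⟨y, hy, rfl⟩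
    exact ⟨x + y, hadd x hx y hy, map_add _ _ _⟩
  have hAsmul : ∀ c : ℝ, 0 ≤ c → ∀ x ∈ A, c • x ∈ A := by
    intro c hc x hx
    have hc' : c ∈ closure {r : ℝ | ∃ q : ℚ, 0 ≤ q ∧ (q : ℝ) = r} := by
      rw [Metric.mem_closure_iff]
      intro ε hε
      obtain ⟨q, hq, hq'⟩ := exists_rat_btwn (show c < c + ε by linarith)
      refine ⟨q, ⟨q, by exact_mod_cast hc.trans hq.le, rfl⟩, ?_⟩
      rw [Real.dist_eq, abs_lt]
      constructor <;> linarith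
    refine map_mem_closure₂ continuous_smul hc' hx ?_
    rintro _ ⟨q, hq, rfl⟩ _ ⟨y, hy, rfl⟩
    exact ⟨q • y, hsmul q hq y hy, hemb q y⟩
  have hnear : ∃ δ : ℚ, 0 < δ ∧ ∀ x : V, (∀ j, |β.repr x j| ≤ δ) →
      (1 / 2 : ℚ) • u - x ∈ Q := by
    have hboth : ∀ j, ∃ t : ℚ, 0 ≤ t ∧ t • u - β j ∈ Q ∧ t • u + β j ∈ Q := by
      intro j
      obtain ⟨s, hs, hs'⟩ := hunit (β j)
      obtain ⟨t, ht, ht'⟩ := hunit (-β j)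
      refine ⟨s + t, add_nonneg hs ht, ?_, ?_⟩
      · convert hadd _ hs' _ (hsmul t ht u hu) using 1; rw [add_smul]; abel
      · convert hadd _ ht' _ (hsmul s hs u hu) using 1; rw [add_smul]; abel
    choose t ht ht₁ ht₂ using hboth
    have hT : 0 ≤ ∑ j, t j := Finset.sum_nonneg fun j _ => ht j
    refine ⟨1 / (2 * (∑ j, t j + 1)), by positivity, fun x hx => ?_⟩
    have hterm : ∀ j, (|β.repr x j| * t j) • u - β.repr x j • β j ∈ Q := by
      intro j
      rcases le_total 0 (β.repr x j) with h | h
      · rw [abs_of_nonneg h, mul_smul, ← smul_sub]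
        exact hsmul _ h _ (ht₁ j)
      · rw [abs_of_nonpos h, mul_smul]
        convert hsmul _ (neg_nonneg.2 h) _ (ht₂ j) using 1
        rw [smul_add, neg_smul _ (β j)]; abel
    have hsum : (∑ j, |β.repr x j| * t j) • u - x ∈ Q := by
      have h := Finset.sum_induction
        (fun j => (|β.repr x j| * t j) • u - β.repr x j • β j) (· ∈ Q)
        (fun a b ha hb => hadd a ha b hb) hzero (s := Finset.univ) (fun j _ => hterm j)
      rwa [Finset.sum_sub_distrib, β.sum_repr, ← Finset.sum_smul] at h
    have hle : ∑ j, |β.repr x j| * t j ≤ 1 / 2 := by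
      calc ∑ j, |β.repr x j| * t j
          ≤ ∑ j, 1 / (2 * (∑ j, t j + 1)) * t j :=
            Finset.sum_le_sum fun j _ => mul_le_mul_of_nonneg_right (hx j) (ht j)
        _ = 1 / (2 * (∑ j, t j + 1)) * ∑ j, t j := by rw [Finset.mul_sum]
        _ ≤ 1 / 2 := by
          rw [div_mul_eq_mul_div, one_mul, div_le_div_iff₀ (by positivity) (by norm_num)]
          linarith
    convert hadd _ hsum _ (hsmul _ (sub_nonneg.2 hle) u hu) using 1
    rw [sub_smul]; abel
  have hnA : -emb u ∉ A := by
    intro hmem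
    obtain ⟨δ, hδ, hδ'⟩ := hnear
    obtain ⟨_, ⟨q, hq, rfl⟩, hdist⟩ := Metric.mem_closure_iff.1 hmem δ (by exact_mod_cast hδ)
    have hq' := hδ' (q + u) fun j => by
      have h := (dist_le_pi_dist (-emb u) (emb q) j).trans hdist.le
      rw [Real.dist_eq, abs_sub_comm] at h
      have h' : emb q j - (-emb u) j = ((β.repr (q + u) j : ℚ) : ℝ) := by simp [emb]
      rw [h'] at h
      exact_mod_cast h
    apply hnu
    have := hsmul 2 (by norm_num) _ (hadd _ hq' _ hq)
    convert this using 1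
    have : (1 / 2 : ℚ) • u - (q + u) + q = (-(1 / 2 : ℚ)) • u := by
      have : (-(1 / 2 : ℚ)) = 1 / 2 - 1 := by norm_num
      rw [this, sub_smul, one_smul]; abel
    rw [this, smul_smul]; norm_num
  have hconv : Convex ℝ A := fun x hx y hy a b ha hb _ =>
    hAadd _ (hAsmul a ha x hx) _ (hAsmul b hb y hy)
  obtain ⟨f, r, hf, hr⟩ := geometric_hahn_banach_closed_point hconv isClosed_closure hnA
  have h0 : 0 < r := by simpa using hf 0 (subset_closure ⟨0, hzero, map_zero _⟩)
  have hneg : ∀ q ∈ Q, f (emb q) ≤ 0 := by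
    intro q hq
    by_contra! hpos
    have := hf _ (hAsmul (r / f (emb q)) (div_nonneg h0.le hpos.le) _
      (subset_closure ⟨q, hq, rfl⟩))
    rw [map_smul, smul_eq_mul, div_mul_cancel₀ _ hpos.ne'] at this
    exact this.false
  obtain ⟨w, hw⟩ := exists_evalCoord_eq β
    ((-(f : (Fin n → ℝ) →+ ℝ)).comp emb)
  have hw' : ∀ v, evalCoord β v w = -f (emb v) := hw
  refine ⟨w, fun q hq => ?_, ?_⟩
  · rw [hw']; linarith [hneg q hq]
  · rw [hw']; rw [map_neg] at hr; linarith

/-- The real states of `(V, P)` normalized at `u`, in coordinates. -/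
def stateSpace (β : Basis (Fin n) ℚ V) (P : Set V) (u : V) : Set (Fin n → ℝ) :=
  {w | (∀ p ∈ P, 0 ≤ evalCoord β p w) ∧ evalCoord β u w = 1}

theorem convex_stateSpace (β : Basis (Fin n) ℚ V) (P : Set V) (u : V) :
    Convex ℝ (stateSpace β P u) := by
  rintro x ⟨hx, hx'⟩ y ⟨hy, hy'⟩ a b ha hb hab
  refine ⟨fun p hp => ?_, ?_⟩
  · rw [map_add, map_smul, map_smul]
    exact add_nonneg (mul_nonneg ha (hx p hp)) (mul_nonneg hb (hy p hp))
  · simp [hx', hy', hab]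

theorem isCompact_stateSpace (β : Basis (Fin n) ℚ V) {u : V}
    (hunit : ∀ v, ∃ t : ℚ, 0 ≤ t ∧ t • u - v ∈ P) : IsCompact (stateSpace β P u) := by
  choose t _ ht using hunit
  refine (isCompact_univ_pi
    (s := fun j => Set.Icc (-(t (-β j) : ℝ)) (t (β j)))
    fun _ => isCompact_Icc).of_isClosed_subset ?_ ?_
  · have : stateSpace β P u =
        (⋂ p ∈ P, {w | 0 ≤ evalCoord β p w}) ∩ {w | evalCoord β u w = 1} := by
      ext; simp [stateSpace]
    rw [this]
    refine IsClosed.inter (isClosed_biInter fun p _ => ?_) ?_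
    · exact isClosed_le continuous_const (evalCoord β p).continuous
    · exact isClosed_eq (evalCoord β u).continuous continuous_const
  · rintro w ⟨hw, hw'⟩ j -
    have h₁ := hw _ (ht (β j))
    have h₂ := hw _ (ht (-β j))
    rw [evalCoord_sub, evalCoord_smul, hw', evalCoord_basis] at h₁
    rw [sub_neg_eq_add, evalCoord_add, evalCoord_smul, hw', evalCoord_basis] at h₂
    constructor <;> linarith

theorem eq_smul_of_le_extremeState (β : Basis (Fin n) ℚ V) {u : V} (hu : u ∈ P)
    (hunit : ∀ v, ∃ t : ℚ, 0 ≤ t ∧ t • u - v ∈ P) {φ w : Fin n → ℝ}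
    (hφ : φ ∈ (stateSpace β P u).extremePoints ℝ) (hw0 : ∀ p ∈ P, 0 ≤ evalCoord β p w)
    (hwφ : ∀ p ∈ P, evalCoord β p w ≤ evalCoord β p φ) (hwu : 0 < evalCoord β u w) :
    w = evalCoord β u w • φ := by
  obtain ⟨⟨hφP, hφu⟩, hext⟩ := mem_extremePoints.1 hφ
  set a := evalCoord β u w with ha
  have ha1 : a ≤ 1 := hφu ▸ hwφ u hu
  rcases ha1.eq_or_lt with ha1 | ha1
  · have hle : ∀ v, evalCoord β v (φ - w) ≤ 0 := by
      intro v
      obtain ⟨t, -, htv⟩ := hunit v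
      have := hwφ _ htv
      simp only [evalCoord_sub, evalCoord_smul, hφu, ← ha, ha1] at this
      rw [map_sub]; linarith
    have hzero : φ - w = 0 := by
      ext j
      have h₁ := hle (β j)
      have h₂ := hle (0 - β j)
      rw [evalCoord_sub, evalCoord_zero, evalCoord_basis] at h₂
      rw [evalCoord_basis] at h₁
      simp only [Pi.zero_apply]
      linarith
    rw [ha1, one_smul, sub_eq_zero.1 hzero]
  · have h1a : 0 < 1 - a := sub_pos.2 ha1
    have := (hext (a⁻¹ • w) ⟨fun p hp => ?_, ?_⟩ ((1 - a)⁻¹ • (φ - w)) ⟨fun p hp => ?_, ?_⟩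
      ⟨a, 1 - a, hwu, h1a, by ring, ?_⟩).1
    · rw [← this, smul_smul, mul_inv_cancel₀ hwu.ne', one_smul]
    · rw [map_smul]
      exact mul_nonneg (inv_nonneg.2 hwu.le) (hw0 p hp)
    · rw [map_smul, smul_eq_mul, ← ha, inv_mul_cancel₀ hwu.ne']
    · rw [map_smul, map_sub]
      exact mul_nonneg (inv_nonneg.2 h1a.le) (sub_nonneg.2 (hwφ p hp))
    · rw [map_smul, map_sub, smul_eq_mul, hφu, ← ha, inv_mul_cancel₀ h1a.ne']
    · rw [smul_smul, smul_smul, mul_inv_cancel₀ hwu.ne', mul_inv_cancel₀ h1a.ne', one_smul,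
        one_smul]
      abel

namespace RieszCone

theorem mem_of_forall_state_pos (h : RieszCone P) (β : Basis (Fin n) ℚ V) {u : V}
    (hu : u ∈ P) (hu0 : u ≠ 0) (hunit : ∀ v, ∃ t : ℚ, 0 ≤ t ∧ t • u - v ∈ P) {v : V}
    (hv : ∀ w ∈ stateSpace β P u, 0 < evalCoord β v w) : v ∈ P := by
  by_contra hvP
  let Q : Set V := {x | ∃ p ∈ P, ∃ t : ℚ, 0 ≤ t ∧ x = p - t • v}
  have hPQ : ∀ p ∈ P, p ∈ Q := fun p hp => ⟨p, hp, 0, le_rfl, by simp⟩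
  obtain ⟨w, hw, hwu⟩ := exists_positive_functional β (Q := Q) (u := u)
    (by
      rintro _ ⟨p, hp, s, hs, rfl⟩ _ ⟨q, hq, t, ht, rfl⟩
      exact ⟨p + q, h.add_mem p hp q hq, s + t, add_nonneg hs ht, by rw [add_smul]; abel⟩)
    (by
      rintro c hc _ ⟨p, hp, s, hs, rfl⟩
      exact ⟨c • p, h.smul_mem c hc p hp, c * s, mul_nonneg hc hs, by
        rw [smul_sub, mul_smul]⟩)
    (hPQ u hu)
    (fun x => (hunit x).imp fun t ht => ⟨ht.1, hPQ _ ht.2⟩)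
    (by
      rintro ⟨p, hp, t, ht, e⟩
      rcases ht.eq_or_lt with rfl | ht
      · exact hu0 (h.pointed u hu (by rw [e]; simpa using hp))
      · apply hvP
        have : v = t⁻¹ • (p + u) := by
          have : p + u = t • v := by
            rw [← neg_neg u, e]; abel
          rw [this, smul_smul, inv_mul_cancel₀ ht.ne', one_smul]
        rw [this]
        exact h.smul_mem _ (inv_nonneg.2 ht.le) _ (h.add_mem p hp u hu))
  have hmem : (evalCoord β u w)⁻¹ • w ∈ stateSpace β P u := by
    refine ⟨fun p hp => ?_, ?_⟩
    · rw [map_smul]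
      exact mul_nonneg (inv_nonneg.2 hwu.le) (hw p (hPQ p hp))
    · rw [map_smul, smul_eq_mul, inv_mul_cancel₀ hwu.ne']
  have h₁ := hv _ hmem
  rw [map_smul, smul_eq_mul] at h₁
  have h₂ : 0 < evalCoord β v w := pos_of_mul_pos_right h₁ (inv_nonneg.2 hwu.le)
  have h₃ := hw (-v) ⟨0, h.zero_mem, 1, zero_le_one, by simp⟩
  rw [← zero_sub, evalCoord_sub, evalCoord_zero] at h₃
  linarith

/-- A real-valued function additive on the positive cone extends to a functional. -/
theorem exists_extension (h : RieszCone P) (β : Basis (Fin n) ℚ V) (g : V → ℝ)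
    (hg : ∀ x ∈ P, ∀ y ∈ P, g (x + y) = g x + g y) : ∃ w, ∀ p ∈ P, evalCoord β p w = g p := by
  choose a ha b hb hab using h.directed
  have key : ∀ x ∈ P, ∀ y ∈ P, g (a (x - y)) - g (b (x - y)) = g x - g y := by
    intro x hx y hy
    have e : a (x - y) + y = x + b (x - y) := by
      have := hab (x - y)
      rw [sub_eq_sub_iff_add_eq_add] at this
      exact this.symm
    have e' := congrArg g e
    rw [hg _ (ha _) _ hy, hg _ hx _ (hb _)] at e'
    linarith
  have hg0 : g 0 = 0 := by simpa using hg 0 h.zero_mem 0 h.zero_mem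
  obtain ⟨w, hw⟩ := exists_evalCoord_eq β (AddMonoidHom.mk' (fun v => g (a v) - g (b v)) (by
    intro x y
    have e : x + y = (a x + a y) - (b x + b y) := by
      conv_lhs => rw [hab x, hab y]
      abel
    have := key _ (h.add_mem _ (ha x) _ (ha y)) _ (h.add_mem _ (hb x) _ (hb y))
    rw [← e, hg _ (ha x) _ (ha y), hg _ (hb x) _ (hb y)] at this
    rw [this]; ring))
  refine ⟨w, fun p hp => (hw p).trans ?_⟩
  have := key p hp 0 h.zero_mem
  rw [sub_zero, hg0, sub_zero] at this
  exact this

/-- Distinct extreme states are disjoint: their infimum in the sense of Riesz and Kantorovich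
vanishes. -/
theorem exists_split (h : RieszCone P) (β : Basis (Fin n) ℚ V) {u : V} (hu : u ∈ P)
    (hunit : ∀ v, ∃ t : ℚ, 0 ≤ t ∧ t • u - v ∈ P) {φ ψ : Fin n → ℝ}
    (hφ : φ ∈ (stateSpace β P u).extremePoints ℝ)
    (hψ : ψ ∈ (stateSpace β P u).extremePoints ℝ) (hne : φ ≠ ψ) {ε : ℝ} (hε : 0 < ε) :
    ∃ x ∈ P, u - x ∈ P ∧ evalCoord β x φ + evalCoord β (u - x) ψ < ε := by
  by_contra! hcon
  have hφP := hφ.1.1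
  have hψP := hψ.1.1
  let A : V → Set ℝ := fun p =>
    {r | ∃ x ∈ P, p - x ∈ P ∧ r = evalCoord β x φ + evalCoord β (p - x) ψ}
  have hAφ : ∀ p ∈ P, evalCoord β p φ ∈ A p := fun p hp =>
    ⟨p, hp, by simpa using h.zero_mem, by simp [evalCoord_zero]⟩
  have hAψ : ∀ p ∈ P, evalCoord β p ψ ∈ A p := fun p hp =>
    ⟨0, h.zero_mem, by simpa using hp, by simp [evalCoord_zero]⟩
  have hA0 : ∀ p, ∀ r ∈ A p, 0 ≤ r := by
    rintro p _ ⟨x, hx, hpx, rfl⟩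
    exact add_nonneg (hφP x hx) (hψP _ hpx)
  have hbdd : ∀ p, BddBelow (A p) := fun p => ⟨0, hA0 p⟩
  have hAadd : ∀ p ∈ P, ∀ q ∈ P, A (p + q) = A p + A q := by
    intro p hp q hq
    ext r
    rw [Set.mem_add]
    constructor
    · rintro ⟨x, hx, hpx, rfl⟩
      obtain ⟨x₁, h₁, x₂, h₂, rfl, h₁', h₂'⟩ := h.decomp x hx p hp q hq hpx
      refine ⟨_, ⟨x₁, h₁, h₁', rfl⟩, _, ⟨x₂, h₂, h₂', rfl⟩, ?_⟩
      simp only [evalCoord_add, evalCoord_sub]; ring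
    · rintro ⟨_, ⟨x₁, h₁, h₁', rfl⟩, _, ⟨x₂, h₂, h₂', rfl⟩, rfl⟩
      refine ⟨x₁ + x₂, h.add_mem _ h₁ _ h₂, ?_, ?_⟩
      · convert h.add_mem _ h₁' _ h₂' using 1; abel
      · simp only [evalCoord_add, evalCoord_sub]; ring
  obtain ⟨w, hw⟩ := h.exists_extension β (fun p => sInf (A p)) (fun p hp q hq => by
    rw [hAadd p hp q hq]
    exact csInf_add ⟨_, hAφ p hp⟩ (hbdd p) ⟨_, hAφ q hq⟩ (hbdd q))
  have hw0 : ∀ p ∈ P, 0 ≤ evalCoord β p w := fun p hp => by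
    rw [hw p hp]
    exact le_csInf ⟨_, hAφ p hp⟩ (hA0 p)
  have hwφ : ∀ p ∈ P, evalCoord β p w ≤ evalCoord β p φ := fun p hp => by
    rw [hw p hp]
    exact csInf_le (hbdd p) (hAφ p hp)
  have hwψ : ∀ p ∈ P, evalCoord β p w ≤ evalCoord β p ψ := fun p hp => by
    rw [hw p hp]
    exact csInf_le (hbdd p) (hAψ p hp)
  have hwu : 0 < evalCoord β u w := by
    rw [hw u hu]
    refine hε.trans_le (le_csInf ⟨_, hAφ u hu⟩ ?_)
    rintro _ ⟨x, hx, hux, rfl⟩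
    exact hcon x hx hux
  have e₁ := eq_smul_of_le_extremeState β hu hunit hφ hw0 hwφ hwu
  have e₂ := eq_smul_of_le_extremeState β hu hunit hψ hw0 hwψ hwu
  exact hne (smul_right_injective _ hwu.ne' (e₁.symm.trans e₂))

theorem exists_peak (h : RieszCone P) (β : Basis (Fin n) ℚ V) {u : V} (hu : u ∈ P)
    (hunit : ∀ v, ∃ t : ℚ, 0 ≤ t ∧ t • u - v ∈ P) {φ : Fin n → ℝ}
    (hφ : φ ∈ (stateSpace β P u).extremePoints ℝ) (T : Finset (Fin n → ℝ)) :
    (∀ ψ ∈ T, ψ ∈ (stateSpace β P u).extremePoints ℝ ∧ φ ≠ ψ) → ∀ ε : ℝ, 0 < ε →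
      ∃ y ∈ P, u - y ∈ P ∧ evalCoord β (u - y) φ < ε ∧ ∀ ψ ∈ T, evalCoord β y ψ < ε := by
  classical
  induction T using Finset.induction_on with
  | empty => exact fun _ ε hε => ⟨u, hu, by simpa using h.zero_mem, by simpa [evalCoord_zero]⟩
  | insert ψ T _ ih =>
    intro hT ε hε
    obtain ⟨y, hy, huy, hyφ, hyT⟩ := ih (fun χ hχ => hT χ (by simp [hχ])) (ε / 2) (by linarith)
    obtain ⟨hψ, hne⟩ := hT ψ (by simp)
    obtain ⟨x, hx, hux, hxε⟩ := h.exists_split β hu hunit hφ hψ hne (half_pos hε)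
    have hx₁ := hφ.1.1 x hx
    have hx₂ := hψ.1.1 _ hux
    obtain ⟨z, hz₁, hz₂, hzu, hzs⟩ := h.interpolation (a₁ := u - y) (a₂ := x) (c₁ := u)
      (c₂ := u - y + x) (by simpa using hy) hux (by simpa using hx) (by simpa using huy)
    refine ⟨u - z, hzu, ?_, ?_, ?_⟩
    · simpa using h.add_mem _ hz₂ _ hx
    · have := hφ.1.1 _ hzs
      rw [evalCoord_sub, evalCoord_add] at this
      rw [sub_sub_cancel]; linarith
    · intro χ hχ
      have hχS : χ ∈ stateSpace β P u := (hT χ hχ).1.1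
      rcases Finset.mem_insert.1 hχ with rfl | hχ
      · have := hχS.1 _ hz₂
        rw [evalCoord_sub] at this hx₂ hxε ⊢
        linarith
      · have := hχS.1 _ hz₁
        have hyχ := hyT χ hχ
        rw [evalCoord_sub, evalCoord_sub] at this
        rw [evalCoord_sub]
        linarith

theorem linearIndepOn_extremePoints (h : RieszCone P) (β : Basis (Fin n) ℚ V) {u : V}
    (hu : u ∈ P) (hunit : ∀ v, ∃ t : ℚ, 0 ≤ t ∧ t • u - v ∈ P) :
    LinearIndepOn ℝ id ((stateSpace β P u).extremePoints ℝ) := by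
  classical
  rw [linearIndepOn_iff']
  intro t a ht hsum φ hφ
  by_contra hne
  set K := ∑ ψ ∈ t, |a ψ| with hK
  have hpos : 0 < |a φ| := abs_pos.2 hne
  have hKφ : |a φ| ≤ K :=
    Finset.single_le_sum (f := fun ψ => |a ψ|) (fun ψ _ => abs_nonneg _) hφ
  have hKpos : 0 < K := hpos.trans_le hKφ
  obtain ⟨y, hy, huy, hyφ, hyt⟩ := h.exists_peak β hu hunit (ht hφ) (t.erase φ)
    (fun ψ hψ => ⟨ht (Finset.mem_of_mem_erase hψ), (Finset.ne_of_mem_erase hψ).symm⟩)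
    (|a φ| / (2 * K)) (by positivity)
  set ε := |a φ| / (2 * K) with hε
  have hεK : ε * K = |a φ| / 2 := by rw [hε]; field_simp
  have hφ1 : 1 - ε ≤ evalCoord β y φ := by
    rw [evalCoord_sub, (ht hφ).1.2] at hyφ; linarith
  have hev := congrArg (evalCoord β y) hsum
  simp only [map_sum, map_smul, id, map_zero, smul_eq_mul] at hev
  rw [← Finset.add_sum_erase _ _ hφ] at hev
  have hrest : |∑ ψ ∈ t.erase φ, a ψ * evalCoord β y ψ| ≤ ∑ ψ ∈ t.erase φ, |a ψ| * ε := by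
    refine (Finset.abs_sum_le_sum_abs _ _).trans (Finset.sum_le_sum fun ψ hψ => ?_)
    rw [abs_mul, abs_of_nonneg ((ht (Finset.mem_of_mem_erase hψ)).1.1 y hy)]
    exact mul_le_mul_of_nonneg_left (hyt ψ hψ).le (abs_nonneg _)
  have hmain : |a φ| * (1 - ε) ≤ ∑ ψ ∈ t.erase φ, |a ψ| * ε := by
    refine le_trans ?_ hrest
    rw [← neg_eq_of_add_eq_zero_right hev, abs_neg, abs_mul,
      abs_of_nonneg ((ht hφ).1.1 y hy)]
    exact mul_le_mul_of_nonneg_left hφ1 (abs_nonneg _)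
  rw [← Finset.sum_mul, Finset.sum_erase_eq_sub hφ, ← hK] at hmain
  nlinarith

end RieszCone

end Functionals

section Covers

open Module

/-- A real simplicial cone, given as `{x | 0 ≤ M *ᵥ x}`, whose interior contains a finite set of
rational points has a rational simplicial subcone, spanned by the columns of `D`, containing these
points and contained in the interior up to the origin. -/
theorem exists_rat_matrix {n : ℕ} {M : Matrix (Fin n) (Fin n) ℝ} (hM : IsUnit M.det)
    {F : Set (Fin n → ℚ)} (hF : F.Finite)
    (hpos : ∀ f ∈ F, ∀ i, 0 < M.mulVec (fun j => (f j : ℝ)) i) :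
    ∃ D : Matrix (Fin n) (Fin n) ℚ, IsUnit D.det ∧
      (∀ i j, 0 < (M * D.map (Rat.castHom ℝ)) i j) ∧ ∀ f ∈ F, ∀ i, 0 < D⁻¹.mulVec f i := by
  let U : Set (Matrix (Fin n) (Fin n) ℝ) := {D | D.det ≠ 0} ∩
    ⋂ f ∈ F, ⋂ i, {D | 0 < D.det * D.adjugate.mulVec (fun j => (f j : ℝ)) i}
  have hU : IsOpen U := by
    refine IsOpen.inter ?_ (hF.isOpen_biInter fun f _ => isOpen_iInter_of_finite fun i => ?_)
    · exact isOpen_ne_fun continuous_id.matrix_det continuous_const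
    · refine isOpen_lt continuous_const (continuous_id.matrix_det.mul ?_)
      exact (continuous_apply i).comp
        (continuous_id.matrix_adjugate.matrix_mulVec continuous_const)
  let W : Set (Matrix (Fin n) (Fin n) ℝ) := ⋂ i, ⋂ j, {D | 0 < (M * D) i j}
  have hW : IsOpen W := by
    refine isOpen_iInter_of_finite fun i => isOpen_iInter_of_finite fun j => ?_
    exact isOpen_lt continuous_const ((continuous_const.matrix_mul continuous_id).matrix_elem i j)
  have hMU : M⁻¹ ∈ U := by
    have hdet : M⁻¹.det ≠ 0 := (Matrix.isUnit_nonsing_inv_det M hM).ne_zero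
    refine ⟨hdet, ?_⟩
    simp only [Set.mem_iInter]
    intro f hf i
    have hadj : M⁻¹.adjugate = M⁻¹.det • M := by
      have h₁ := Matrix.adjugate_mul M⁻¹
      calc M⁻¹.adjugate = M⁻¹.adjugate * (M⁻¹ * M) := by
            rw [Matrix.nonsing_inv_mul M hM, mul_one]
        _ = M⁻¹.det • M := by rw [← mul_assoc, h₁, smul_mul_assoc, one_mul]
    change 0 < M⁻¹.det * M⁻¹.adjugate.mulVec (fun j => (f j : ℝ)) i
    rw [hadj, Matrix.smul_mulVec, Pi.smul_apply, smul_eq_mul, ← mul_assoc]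
    exact mul_pos (mul_self_pos.2 hdet) (hpos f hf i)
  let g : ℝ → Matrix (Fin n) (Fin n) ℝ := fun ε => M⁻¹ * (1 + ε • Matrix.of fun _ _ => 1)
  have hg : Continuous g :=
    continuous_const.matrix_mul (continuous_const.add (continuous_id.smul continuous_const))
  have hev : ∀ᶠ ε in nhds 0, g ε ∈ U :=
    hg.continuousAt.eventually_mem (hU.mem_nhds (by simpa [g] using hMU))
  obtain ⟨δ, hδ, hball⟩ := Metric.eventually_nhds_iff.1 hev
  have hne : (U ∩ W).Nonempty := by
    refine ⟨g (δ / 2), hball ?_, ?_⟩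
    · rw [Real.dist_eq, sub_zero, abs_of_pos (half_pos hδ)]; linarith
    · simp only [W, Set.mem_iInter]
      intro i j
      change 0 < (M * g (δ / 2)) i j
      simp only [g]
      rw [← mul_assoc, Matrix.mul_nonsing_inv M hM, one_mul]
      have : (0 : ℝ) ≤ (1 : Matrix (Fin n) (Fin n) ℝ) i j := by
        rw [Matrix.one_apply]; split_ifs <;> norm_num
      simp only [Matrix.add_apply, Matrix.smul_apply, Matrix.of_apply, smul_eq_mul, mul_one]
      linarith
  have hdense : DenseRange (fun D : Matrix (Fin n) (Fin n) ℚ => D.map (Rat.castHom ℝ)) :=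
    DenseRange.piMap fun _ => DenseRange.piMap fun _ => Rat.denseRange_cast
  obtain ⟨D, ⟨hD₁, hD₂⟩, hD₃⟩ := hdense.exists_mem_open (hU.inter hW) hne
  simp only [Set.mem_iInter] at hD₂
  simp only [W, Set.mem_iInter] at hD₃
  have hdet : (D.map (Rat.castHom ℝ)).det = (D.det : ℝ) :=
    ((Rat.castHom ℝ).map_det D).symm
  have hD : D.det ≠ 0 := by
    intro h
    apply hD₁
    rw [hdet, h, Rat.cast_zero]
  refine ⟨D, isUnit_iff_ne_zero.2 hD, hD₃, fun f hf i => ?_⟩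
  have h₁ : 0 < (D.map (Rat.castHom ℝ)).det *
      (D.map (Rat.castHom ℝ)).adjugate.mulVec (fun j => (f j : ℝ)) i := hD₂ f hf i
  have h₂ : (D.map (Rat.castHom ℝ)).adjugate.mulVec (fun j => (f j : ℝ)) i =
      ((D.adjugate.mulVec f i : ℚ) : ℝ) := by
    have : (D.map (Rat.castHom ℝ)).adjugate = D.adjugate.map (Rat.castHom ℝ) :=
      ((Rat.castHom ℝ).map_adjugate D).symm
    rw [this]
    simp [Matrix.mulVec, dotProduct]
  rw [h₂, hdet] at h₁
  have h₃ : 0 < D.det * D.adjugate.mulVec f i := by exact_mod_cast h₁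
  rw [Matrix.inv_def, Matrix.smul_mulVec, Pi.smul_apply, smul_eq_mul, Ring.inverse_eq_inv']
  have : D.det⁻¹ * D.adjugate.mulVec f i =
      (D.det * D.adjugate.mulVec f i) * (D.det⁻¹ * D.det⁻¹) := by
    field_simp
  rw [this]
  exact mul_pos h₃ (mul_self_pos.2 (inv_ne_zero hD))

namespace RieszCone

/-- The simple case: every nonzero positive element is an order unit. -/
theorem hasSimplicialCovers_of_simple {V : Type*} [AddCommGroup V] [Module ℚ V] {P : Set V}
    (h : RieszCone P) {n : ℕ} (β : Basis (Fin n) ℚ V) {u : V} (hu : u ∈ P) (hu0 : u ≠ 0)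
    (hunit : ∀ x ∈ P, x ≠ 0 → ∀ v, ∃ t : ℚ, 0 ≤ t ∧ t • x - v ∈ P) :
    HasSimplicialCovers P := by
  intro F hF hFP
  set S := stateSpace β P u
  have hSc : IsCompact S := isCompact_stateSpace β (hunit u hu hu0)
  have hpos : ∀ f ∈ P, f ≠ 0 → ∀ w ∈ S, 0 < evalCoord β f w := by
    intro f hf hf0 w hw
    obtain ⟨t, ht, htu⟩ := hunit f hf hf0 u
    have h₁ := hw.1 _ htu
    rw [evalCoord_sub, evalCoord_smul, hw.2] at h₁
    exact pos_of_mul_pos_right (by linarith) (Rat.cast_nonneg.2 ht)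
  have hSne : S.Nonempty := by
    by_contra hempty
    rw [Set.not_nonempty_iff_eq_empty] at hempty
    refine hu0 (h.pointed u hu (h.mem_of_forall_state_pos β hu hu0 (hunit u hu hu0) ?_))
    intro w hw
    exact absurd (show w ∈ S from hw) (by simp [hempty])
  set T : Set (Fin n → ℝ) := ⋂ f ∈ F \ {0}, {w | 0 < evalCoord β f w}
  have hT : IsOpen T := (hF.sdiff).isOpen_biInter fun f _ =>
    isOpen_lt continuous_const (evalCoord β f).continuous
  have hST : S ⊆ T := fun w hw => by
    simp only [T, Set.mem_iInter]
    exact fun f hf => hpos f (hFP hf.1) hf.2 w hw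
  obtain ⟨b, hbT, hSb, hTb, hb⟩ := exists_linearIndepOn_id_extension
    (h.linearIndepOn_extremePoints β hu (hunit u hu hu0)) (extremePoints_subset.trans hST)
  have hspan : Submodule.span ℝ b = ⊤ := by
    refine Submodule.eq_top_of_nonempty_interior' _ ?_
    obtain ⟨w, hw⟩ := hSne
    exact ⟨w, interior_maximal hTb hT (hST hw)⟩
  let B : Basis b ℝ (Fin n → ℝ) := Basis.mk (v := fun x : b => (x : Fin n → ℝ)) hb
    (by simp [hspan])
  let e : b ≃ Fin n := B.indexEquiv (Pi.basisFun ℝ (Fin n))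
  let m : Fin n → Fin n → ℝ := fun i => (e.symm i : b)
  have hmb : ∀ i, m i ∈ b := fun i => (e.symm i).2
  have hbm : ∀ x ∈ b, ∃ i, m i = x := fun x hx => ⟨e ⟨x, hx⟩, by simp [m]⟩
  have hmli : LinearIndependent ℝ m := LinearIndependent.comp hb _ e.symm.injective
  have hmP : ∀ v, (∀ i, 0 < evalCoord β v (m i)) → v ∈ P := by
    intro v hv
    refine h.mem_of_forall_state_pos β hu hu0 (hunit u hu hu0) fun w hw => ?_
    obtain ⟨x₀, hx₀⟩ := hSc.extremePoints_nonempty hSne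
    obtain ⟨i₀, -⟩ := hbm x₀ (hSb hx₀)
    obtain ⟨i₁, -, hi₁⟩ := Finset.exists_min_image Finset.univ (fun i => evalCoord β v (m i))
      ⟨i₀, Finset.mem_univ _⟩
    refine (hv i₁).trans_le ?_
    have hsub : closure (convexHull ℝ (S.extremePoints ℝ)) ⊆
        {x | evalCoord β v (m i₁) ≤ evalCoord β v x} := by
      refine closure_minimal (convexHull_min ?_ ?_)
        (isClosed_le continuous_const (evalCoord β v).continuous)
      · intro x hx
        obtain ⟨i, rfl⟩ := hbm x (hSb hx)
        exact hi₁ i (Finset.mem_univ i)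
      · exact convex_halfSpace_ge (evalCoord β v).isLinear _
    rw [closure_convexHull_extremePoints hSc (convex_stateSpace β P u)] at hsub
    exact hsub hw
  have hM : IsUnit (Matrix.of m).det := by
    rw [← Matrix.isUnit_iff_isUnit_det, ← Matrix.linearIndependent_rows_iff_isUnit]
    exact hmli
  obtain ⟨D, hD, hDpos, hDF⟩ := exists_rat_matrix hM
    ((hF.sdiff (t := {0})).image β.equivFun) (by
      rintro _ ⟨f, hf, rfl⟩ i
      have := hbT (hmb i)
      simp only [T, Set.mem_iInter] at this
      have h₁ : 0 < evalCoord β f (m i) := this f hf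
      rw [evalCoord_apply] at h₁
      simpa [Matrix.mulVec, dotProduct, mul_comm] using h₁)
  refine ⟨Fin n, inferInstance, fun j => β.equivFun.symm (D.col j), ?_, ?_, ?_⟩
  · have : LinearIndependent ℚ D.col := by
      rw [Matrix.linearIndependent_cols_iff_isUnit, Matrix.isUnit_iff_isUnit_det]
      exact hD
    exact this.map' (β.equivFun.symm : (Fin n → ℚ) →ₗ[ℚ] V) β.equivFun.symm.ker
  · refine fun j => hmP _ fun i => ?_
    have h₁ := hDpos i j
    have h₂ : ∀ k, β.repr (β.equivFun.symm (D.col j)) k = D k j := fun k => by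
      rw [← Basis.equivFun_apply, LinearEquiv.apply_symm_apply]; rfl
    rw [evalCoord_apply]
    simp only [h₂]
    simpa [Matrix.mul_apply, mul_comm] using h₁
  · intro f hf
    rcases eq_or_ne f 0 with rfl | hf0
    · exact ⟨0, fun _ => le_rfl, by simp⟩
    · refine ⟨D⁻¹.mulVec (β.equivFun f), fun i => (hDF _ ⟨f, ⟨hf, hf0⟩, rfl⟩ i).le, ?_⟩
      apply β.equivFun.injective
      rw [map_sum]
      simp only [map_smul, LinearEquiv.apply_symm_apply]
      calc β.equivFun f = D.mulVec (D⁻¹.mulVec (β.equivFun f)) := by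
            rw [Matrix.mulVec_mulVec, Matrix.mul_nonsing_inv D hD, Matrix.one_mulVec]
        _ = _ := by
          ext i
          simp [Matrix.mulVec, dotProduct, mul_comm]

theorem hasSimplicialCovers_of_finrank (n : ℕ) :
    ∀ (V : Type*) [AddCommGroup V] [Module ℚ V] [FiniteDimensional ℚ V] (P : Set V),
      RieszCone P → finrank ℚ V = n → HasSimplicialCovers P := by
  induction n using Nat.strong_induction_on with
  | _ n ih =>
    intro V _ _ _ P h hn
    by_cases hP : ∃ u ∈ P, u ≠ 0
    · obtain ⟨u, hu, hu0⟩ := hP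
      by_cases hs : ∀ x ∈ P, x ≠ 0 → ∀ v, ∃ t : ℚ, 0 ≤ t ∧ t • x - v ∈ P
      · exact h.hasSimplicialCovers_of_simple (finBasis ℚ V) hu hu0 hs
      · push Not at hs
        obtain ⟨x, hx, hx0, v, hv⟩ := hs
        have hI := h.isOrderIdeal_principalIdeal hx
        set I := h.principalIdeal x
        have hxI : x ∈ I :=
          ⟨1, zero_le_one, by simpa using h.zero_mem, by simpa using h.add_mem x hx x hx⟩
        have hlt : finrank ℚ I < finrank ℚ V := Submodule.finrank_lt (by
          intro htop
          have hvI : v ∈ I := htop ▸ Submodule.mem_top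
          obtain ⟨t, ht, h₁, -⟩ := hvI
          exact hv t ht h₁)
        have hpos : 0 < finrank ℚ I :=
          finrank_pos_iff_exists_ne_zero.2 ⟨⟨x, hxI⟩, fun h0 => hx0 (congrArg Subtype.val h0)⟩
        have hadd := I.finrank_quotient_add_finrank
        exact h.hasSimplicialCovers_of_ideal hI
          (ih _ (by omega) I _ (h.ideal hI) rfl)
          (ih _ (by omega) (V ⧸ I) _ (h.quotient hI) rfl)
    · push Not at hP
      intro F _ hFP
      exact ⟨Empty, inferInstance, Empty.elim, linearIndependent_empty_type, by simp,
        fun f hf => ⟨Empty.elim, by simp, by simpa using hP f (hFP hf)⟩⟩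

/-- Every finite set of positive elements lies in the monoid generated by some basis of positive
elements. -/
theorem exists_basis {V : Type*} [AddCommGroup V] [Module ℚ V] [FiniteDimensional ℚ V]
    {P : Set V} (h : RieszCone P) {n : ℕ} (hn : finrank ℚ V = n) {F : Set V} (hF : F.Finite)
    (hFP : F ⊆ P) :
    ∃ b : Basis (Fin n) ℚ V, (∀ i, b i ∈ P) ∧
      ∀ f ∈ F, ∃ z : Fin n → ℤ, (∀ i, 0 ≤ z i) ∧ f = ∑ i, z i • b i := by
  classical
  obtain ⟨ι, _, b, hb, hbP, hbF⟩ := hasSimplicialCovers_of_finrank n V P h hn F hF hFP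
  have hspanP : Submodule.span ℚ P = ⊤ := by
    refine eq_top_iff.2 fun v _ => ?_
    obtain ⟨x, hx, y, hy, rfl⟩ := h.directed v
    exact sub_mem (Submodule.subset_span hx) (Submodule.subset_span hy)
  obtain ⟨s, hsP, hbs, hPs, hs⟩ := exists_linearIndepOn_id_extension hb.linearIndepOn_id
    (Set.range_subset_iff.2 hbP)
  have hspan : Submodule.span ℚ s = ⊤ :=
    top_le_iff.1 (hspanP ▸ Submodule.span_le.2 hPs)
  let B₀ : Basis s ℚ V := Basis.mk (v := fun x : s => (x : V)) hs (by simp [hspan])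
  let B : Basis (Fin n) ℚ V := B₀.reindex (B₀.indexEquiv (finBasisOfFinrankEq ℚ V hn))
  have hBs : Set.range B = s := by
    rw [Basis.range_reindex]
    exact (congrArg Set.range (Basis.coe_mk hs _)).trans Subtype.range_coe
  have hBP : ∀ i, B i ∈ P := fun i => hsP (hBs ▸ Set.mem_range_self i)
  have hrepr : ∀ f ∈ F, ∀ i, 0 ≤ B.repr f i := by
    intro f hf i
    obtain ⟨c, hc, rfl⟩ := hbF f hf
    rw [map_sum, Finsupp.finsetSum_apply]
    refine Finset.sum_nonneg fun k _ => ?_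
    obtain ⟨j, hj⟩ : b k ∈ Set.range B := hBs ▸ hbs (Set.mem_range_self k)
    rw [map_smul, ← hj, Basis.repr_self, Finsupp.smul_apply, Finsupp.single_apply, smul_eq_mul]
    exact mul_nonneg (hc k) (by split_ifs <;> norm_num)
  set N : ℕ := ∏ f ∈ hF.toFinset, ∏ i, (B.repr f i).den with hN
  have hN0 : (N : ℚ) ≠ 0 := by
    rw [Nat.cast_ne_zero, hN]
    exact Finset.prod_ne_zero_iff.2 fun f _ => Finset.prod_ne_zero_iff.2 fun i _ => Rat.den_nz _
  have hint : ∀ f ∈ F, ∀ i, ∃ z : ℤ, 0 ≤ z ∧ (z : ℚ) = N * B.repr f i := by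
    intro f hf i
    obtain ⟨k, hk⟩ : (B.repr f i).den ∣ N :=
      (Finset.dvd_prod_of_mem (fun i => (B.repr f i).den) (Finset.mem_univ i)).trans
        (Finset.dvd_prod_of_mem (fun f => ∏ i, (B.repr f i).den) (hF.mem_toFinset.2 hf))
    refine ⟨k * (B.repr f i).num,
      mul_nonneg (Int.natCast_nonneg k) (Rat.num_nonneg.2 (hrepr f hf i)), ?_⟩
    rw [hk]
    push_cast
    rw [mul_comm ((B.repr f i).den : ℚ), mul_assoc, Rat.den_mul_eq_num]
  let b' : Basis (Fin n) ℚ V := B.unitsSMul fun _ => (Units.mk0 (N : ℚ) hN0)⁻¹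
  have hb' : ∀ i, b' i = (N : ℚ)⁻¹ • B i := fun i => by
    simp [b', Basis.unitsSMul_apply, Units.smul_def]
  refine ⟨b', fun i => ?_, fun f hf => ?_⟩
  · rw [hb']
    exact h.smul_mem _ (inv_nonneg.2 (Nat.cast_nonneg N)) _ (hBP i)
  · choose z hz hz' using hint f hf
    refine ⟨z, hz, ?_⟩
    conv_lhs => rw [← B.sum_repr f]
    refine Finset.sum_congr rfl fun i _ => ?_
    rw [hb', ← Int.cast_smul_eq_zsmul ℚ (z i), hz', smul_smul]
    congr 1
    field_simp

end RieszCone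

end Covers

/-- Every `n`-dimensional ordered directed `ℚ`-vector space `(V, P)` with Riesz
interpolation is, as an ordered abelian group, the inductive limit of a sequence of
ordered groups `(ℤⁿ, ℤ_{≥0}ⁿ)` with positivity-preserving group homomorphisms:
there are connecting maps `φ i` preserving the positive orthant and canonical maps
`f i : ℤⁿ → V` satisfying the direct-limit conditions, with `P = ⋃ i, f i (ℤ_{≥0}ⁿ)`. -/
theorem stmt17 (V : Type*) [AddCommGroup V] [Module ℚ V]
    (n : ℕ) [FiniteDimensional ℚ V] (hdim : Module.finrank ℚ V = n)
    (P : Set V)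
    (h0 : P ∩ (-P) = {0})
    (hadd : ∀ x ∈ P, ∀ y ∈ P, x + y ∈ P)
    (hsmul : ∀ c : ℚ, 0 ≤ c → ∀ x ∈ P, c • x ∈ P)
    (hdir : ∀ v : V, ∃ a ∈ P, ∃ b ∈ P, v = a - b)
    (hinterp : ∀ a₁ a₂ c₁ c₂ : V,
      c₁ - a₁ ∈ P → c₁ - a₂ ∈ P → c₂ - a₁ ∈ P → c₂ - a₂ ∈ P →
      ∃ b : V, b - a₁ ∈ P ∧ b - a₂ ∈ P ∧ c₁ - b ∈ P ∧ c₂ - b ∈ P) :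
    ∃ (φ : ℕ → ((Fin n → ℤ) →+ (Fin n → ℤ))) (f : ℕ → ((Fin n → ℤ) →+ V)),
      (∀ i, φ i '' {z : Fin n → ℤ | ∀ j, 0 ≤ z j} ⊆ {z : Fin n → ℤ | ∀ j, 0 ≤ z j}) ∧
      (∀ i x, f (i + 1) (φ i x) = f i x) ∧
      (∀ v : V, ∃ i x, f i x = v) ∧
      (∀ i x, f i x = 0 → ∃ k, iterA n φ i k x = 0) ∧
      P = ⋃ i, f i '' {z : Fin n → ℤ | ∀ j, 0 ≤ z j} := by
  have h : RieszCone P :=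
    { zero_mem := by
        have : (0 : V) ∈ P ∩ -P := h0 ▸ rfl
        exact this.1
      pointed := fun x hx hx' => by
        have : x ∈ P ∩ -P := ⟨hx, hx'⟩
        rwa [h0] at this
      add_mem := hadd
      smul_mem := hsmul
      directed := hdir
      decomp := fun x hx y hy z hz hxyz => by
        obtain ⟨b, hb₁, hb₂, hb₃, hb₄⟩ := hinterp 0 (x - z) x y (by simpa using hx)
          (by simpa using hz) (by simpa using hy) (by convert hxyz using 1; abel)
        exact ⟨b, by simpa using hb₁, x - b, hb₃, by abel, hb₄, by convert hb₂ using 1; abel⟩ }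
  have hcount : Countable V :=
    ((Module.finBasisOfFinrankEq ℚ V hdim).equivFun.toEquiv.countable_iff).2 inferInstance
  obtain ⟨p, hp⟩ := P.to_countable.exists_eq_range ⟨0, h.zero_mem⟩
  let Stage := {b : Module.Basis (Fin n) ℚ V // ∀ i, b i ∈ P}
  have hstep : ∀ (i : ℕ) (b : Stage), ∃ b' : Stage,
      ∀ f ∈ p '' Set.Iic i ∪ Set.range b.1, ∃ z : Fin n → ℤ,
        (∀ j, 0 ≤ z j) ∧ f = ∑ j, z j • b'.1 j := by
    intro i b
    obtain ⟨b', hb', hF⟩ := h.exists_basis hdim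
      (((Set.finite_Iic i).image p).union (Set.finite_range b.1)) (Set.union_subset
        (Set.image_subset_iff.2 fun j _ => hp ▸ Set.mem_range_self j)
        (Set.range_subset_iff.2 b.2))
    exact ⟨⟨b', hb'⟩, hF⟩
  choose next hnext using hstep
  obtain ⟨b₀, hb₀, -⟩ := h.exists_basis hdim Set.finite_empty (Set.empty_subset P)
  obtain ⟨b, hb⟩ : ∃ b : ℕ → Stage, ∀ i, b (i + 1) = next i (b i) :=
    ⟨fun i => Nat.rec ⟨b₀, hb₀⟩ next i, fun _ => rfl⟩
  replace hnext := fun i => hnext i (b i)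
  simp only [← hb] at hnext
  have hconn : ∀ i j, ∃ z : Fin n → ℤ, (∀ k, 0 ≤ z k) ∧
      (b i).1 j = ∑ k, z k • (b (i + 1)).1 k :=
    fun i j => hnext i _ (Or.inr (Set.mem_range_self j))
  choose z hz hzb using hconn
  let f : ℕ → ((Fin n → ℤ) →+ V) := fun i =>
    (Fintype.linearCombination ℤ (fun j => (b i).1 j)).toAddMonoidHom
  have hf : ∀ i x, f i x = ∑ j, x j • (b i).1 j := fun i x =>
    Fintype.linearCombination_apply ℤ _ x
  let φ : ℕ → ((Fin n → ℤ) →+ (Fin n → ℤ)) := fun i =>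
    (Fintype.linearCombination ℤ (z i)).toAddMonoidHom
  have hφ : ∀ i x, φ i x = ∑ j, x j • z i j := fun i x =>
    Fintype.linearCombination_apply ℤ _ x
  have hcover : ∀ i, ∀ j ≤ i, ∃ x : Fin n → ℤ, (∀ k, 0 ≤ x k) ∧ f (i + 1) x = p j := by
    intro i j hj
    obtain ⟨x, hx, hx'⟩ := hnext i (p j) (Or.inl ⟨j, hj, rfl⟩)
    exact ⟨x, hx, (hf _ _).trans hx'.symm⟩
  have hmem : ∀ v ∈ P, ∃ j, p j = v := fun v hv => by rwa [hp] at hv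
  refine ⟨φ, f, ?_, ?_, ?_, ?_, ?_⟩
  · rintro i _ ⟨x, hx, rfl⟩ k
    rw [hφ, Finset.sum_apply]
    exact Finset.sum_nonneg fun j _ => mul_nonneg (hx j) (hz i j k)
  · intro i x
    rw [hφ, map_sum, hf]
    refine Finset.sum_congr rfl fun j _ => ?_
    rw [map_zsmul, hf, hzb]
  · intro v
    obtain ⟨x, hx, y, hy, rfl⟩ := hdir v
    obtain ⟨j, rfl⟩ := hmem x hx
    obtain ⟨k, rfl⟩ := hmem y hy
    obtain ⟨x', -, hx'⟩ := hcover (max j k) j (le_max_left _ _)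
    obtain ⟨y', -, hy'⟩ := hcover (max j k) k (le_max_right _ _)
    exact ⟨_, x' - y', by rw [map_sub, hx', hy']⟩
  · intro i x hx
    refine ⟨0, ?_⟩
    have hli : LinearIndependent ℤ (fun j => (b i).1 j) :=
      (b i).1.linearIndependent.restrict_scalars' ℤ
    rw [hf] at hx
    exact funext (Fintype.linearIndependent_iff.1 hli x hx)
  · ext v
    simp only [Set.mem_iUnion]
    constructor
    · intro hv
      obtain ⟨j, rfl⟩ := hmem v hv
      obtain ⟨x, hx, hx'⟩ := hcover j j le_rfl
      exact ⟨_, x, hx, hx'⟩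
    · rintro ⟨i, x, hx, rfl⟩
      rw [hf]
      refine h.sum_mem _ _ fun j _ => ?_
      rw [← Int.cast_smul_eq_zsmul ℚ]
      exact hsmul _ (Int.cast_nonneg (hx j)) _ ((b i).2 j)
end
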